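/- arXiv:2511.20824 — 5 statements merged into one kernel-verified Lean document; each statement's English description precedes it below -/
import Mathlib

section
/- Let b > 0 and δ > 0, and let φ'(t) = (b/(δ sinh b)) · I₀(b·√(1 − (2t/δ − 1)²)) for 0 ≤ t ≤ δ and φ'(t) = 0 otherwise, where I₀(x) = (1/π)∫₀^π e^{x cos θ} dθ is the modified Bessel function of order zero. Then for every real ω with |ω| > 2b/δ, writing s = √((δω/2)² − b²), one has the exact identity ∫₀^δ φ'(t) e^{iω(t − δ/2)} dt = (b / sinh b) · sin(s)/s. -/
open Real MeasureTheory

/-- Modified Bessel function of the first kind of order zero,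
`I₀(x) = (1/π) ∫₀^π e^{x cos θ} dθ`. -/
noncomputable def besselI0 (x : ℝ) : ℝ :=
  (1 / π) * ∫ θ in (0:ℝ)..π, Real.exp (x * Real.cos θ)

/-- The Kaiser–Bessel window derivative `φ'` with shape parameter `b` on `[0, δ]`. -/
noncomputable def kbDeriv (b δ t : ℝ) : ℝ :=
  if 0 ≤ t ∧ t ≤ δ then
    (b / (δ * Real.sinh b)) * besselI0 (b * Real.sqrt (1 - (2 * t / δ - 1) ^ 2))
  else 0

noncomputable def kbW (b c : ℂ) (p q : ℝ) : ℂ :=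
  c * Real.cos p + b * Real.sin p * Real.cos q

noncomputable def kbJ (b c : ℂ) (n : ℕ) : ℂ :=
  ∫ p in (0:ℝ)..π, ∫ q in (0:ℝ)..π, (Real.sin p : ℂ) * kbW b c p q ^ n

lemma kbW_cont (b c : ℂ) : Continuous (fun x : ℝ × ℝ => kbW b c x.1 x.2) := by
  unfold kbW; fun_prop

lemma kb_swap (F : ℝ → ℝ → ℂ) (hF : Continuous F.uncurry) :
    ∫ p in (0:ℝ)..π, ∫ q in (0:ℝ)..π, F p q = ∫ q in (0:ℝ)..π, ∫ p in (0:ℝ)..π, F p q := by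
  apply MeasureTheory.intervalIntegral_intervalIntegral_swap
  apply (hF.continuousOn.integrableOn_compact
    (isCompact_uIcc.prod isCompact_uIcc : IsCompact (Set.uIcc 0 π ×ˢ Set.uIcc 0 π))).mono_set
  exact Set.prod_mono Set.uIoc_subset_uIcc Set.uIoc_subset_uIcc

lemma kb_cosd (p : ℝ) : HasDerivAt (fun p : ℝ => (Real.cos p : ℂ)) (-(Real.sin p : ℂ)) p := by
  simpa using (Real.hasDerivAt_cos p).ofReal_comp

lemma kb_sind (p : ℝ) : HasDerivAt (fun p : ℝ => (Real.sin p : ℂ)) (Real.cos p : ℂ) p := by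
  simpa using (Real.hasDerivAt_sin p).ofReal_comp

lemma kb_sq (p : ℝ) : (Real.sin p : ℂ) ^ 2 = 1 - (Real.cos p : ℂ) ^ 2 := by
  have := Real.sin_sq p
  exact_mod_cast this

lemma kb_div (b c : ℂ) (m : ℕ) :
    ∫ p in (0:ℝ)..π, ∫ q in (0:ℝ)..π, (Real.sin p : ℂ) *
      (-2 * kbW b c p q ^ (m + 1) +
        m * kbW b c p q ^ (m - 1) * (b ^ 2 + c ^ 2 - kbW b c p q ^ 2)) = 0 := by
  set A' : ℝ → ℝ → ℂ := fun p q =>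
    ((Real.cos p : ℂ) * (-c * Real.sin p + b * Real.cos p * Real.cos q)
      + (Real.sin p : ℂ) * (-c * Real.cos p - b * Real.sin p * Real.cos q)) * kbW b c p q ^ m
    + (Real.sin p : ℂ) * (-c * Real.sin p + b * Real.cos p * Real.cos q) *
      (m * kbW b c p q ^ (m - 1) * (-c * Real.sin p + b * Real.cos p * Real.cos q)) with hA'
  set B' : ℝ → ℝ → ℂ := fun p q =>
    (-b * Real.cos q) * kbW b c p q ^ m
    + (-b * Real.sin q) * (m * kbW b c p q ^ (m - 1) * (-b * Real.sin p * Real.sin q)) with hB'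
  have hW := kbW_cont b c
  have cA : Continuous A'.uncurry := by
    simp only [hA', Function.uncurry_def]; fun_prop
  have cB : Continuous B'.uncurry := by
    simp only [hB', Function.uncurry_def]; fun_prop
  have iA : ∀ q, ∫ p in (0:ℝ)..π, A' p q = 0 := by
    intro q
    have hd : ∀ p : ℝ, HasDerivAt (fun p : ℝ => (Real.sin p : ℂ) *
        (-c * Real.sin p + b * Real.cos p * Real.cos q) * kbW b c p q ^ m) (A' p q) p := by
      intro p
      have hw : HasDerivAt (fun p => kbW b c p q)
          (-c * Real.sin p + b * Real.cos p * Real.cos q) p := by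
        have := ((kb_cosd p).const_mul c).add (((kb_sind p).const_mul b).mul_const (Real.cos q : ℂ))
        refine this.congr_deriv ?_
        ring
      have h2 : HasDerivAt (fun p : ℝ => (-c * Real.sin p + b * Real.cos p * Real.cos q : ℂ))
          (-c * Real.cos p - b * Real.sin p * Real.cos q) p := by
        have := ((kb_sind p).const_mul (-c)).add
          (((kb_cosd p).const_mul b).mul_const (Real.cos q : ℂ))
        refine this.congr_deriv ?_
        ring
      exact ((kb_sind p).mul h2).mul (hw.pow m)
    rw [intervalIntegral.integral_eq_sub_of_hasDerivAt (fun p _ => hd p)]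
    · simp
    · exact (cA.comp (by fun_prop : Continuous fun p : ℝ => (p, q))).intervalIntegrable _ _
  have iB : ∀ p, ∫ q in (0:ℝ)..π, B' p q = 0 := by
    intro p
    have hd : ∀ q : ℝ, HasDerivAt (fun q : ℝ => (-b * Real.sin q) * kbW b c p q ^ m)
        (B' p q) q := by
      intro q
      have hw : HasDerivAt (fun q => kbW b c p q) (-b * Real.sin p * Real.sin q) q := by
        have := ((kb_cosd q).const_mul (b * Real.sin p)).const_add (c * Real.cos p)
        refine this.congr_deriv ?_
        ring
      exact ((kb_sind q).const_mul (-b)).mul (hw.pow m)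
    rw [intervalIntegral.integral_eq_sub_of_hasDerivAt (fun p _ => hd p)]
    · simp
    · exact (cB.comp (by fun_prop : Continuous fun q : ℝ => (p, q))).intervalIntegrable _ _
  have key : ∀ p q : ℝ, (Real.sin p : ℂ) *
      (-2 * kbW b c p q ^ (m + 1) +
        m * kbW b c p q ^ (m - 1) * (b ^ 2 + c ^ 2 - kbW b c p q ^ 2)) = A' p q + B' p q := by
    intro p q
    have e1 : -2 * (Real.sin p : ℂ) * kbW b c p q =
      ((Real.cos p : ℂ) * (-c * Real.sin p + b * Real.cos p * Real.cos q)
      + (Real.sin p : ℂ) * (-c * Real.cos p - b * Real.sin p * Real.cos q)) +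
        (-b * Real.cos q) := by
      unfold kbW
      linear_combination (-b * Real.cos q) * kb_sq p
    have e2 : b ^ 2 + c ^ 2 - kbW b c p q ^ 2 =
      (-c * Real.sin p + b * Real.cos p * Real.cos q) ^ 2 + b ^ 2 * (Real.sin q : ℂ) ^ 2 := by
      unfold kbW
      linear_combination (-c ^ 2 - b ^ 2 * (Real.cos q : ℂ) ^ 2) * kb_sq p - b ^ 2 * kb_sq q
    simp only [hA', hB']
    rw [e2]
    linear_combination kbW b c p q ^ m * e1
  simp_rw [key]
  have : ∀ p : ℝ, ∫ q in (0:ℝ)..π, (A' p q + B' p q) = ∫ q in (0:ℝ)..π, A' p q := by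
    intro p
    rw [intervalIntegral.integral_add, iB, add_zero]
    · exact (cA.comp (by fun_prop : Continuous fun q : ℝ => (p, q))).intervalIntegrable _ _
    · exact (cB.comp (by fun_prop : Continuous fun q : ℝ => (p, q))).intervalIntegrable _ _
  simp_rw [this]
  rw [kb_swap A' cA]
  simp [iA]

lemma kb_inner_cont (b c : ℂ) (n : ℕ) :
    Continuous fun p : ℝ => ∫ q in (0:ℝ)..π, (Real.sin p : ℂ) * kbW b c p q ^ n := by
  have hW := kbW_cont b c
  apply intervalIntegral.continuous_parametric_intervalIntegral_of_continuous'
  simp only [Function.uncurry_def]; fun_prop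

lemma kb_q_int (b c : ℂ) (n : ℕ) (p : ℝ) : IntervalIntegrable
    (fun q : ℝ => (Real.sin p : ℂ) * kbW b c p q ^ n) volume 0 π := by
  apply Continuous.intervalIntegrable
  unfold kbW; fun_prop

lemma kbJ_one (b c : ℂ) : kbJ b c 1 = 0 := by
  have h := kb_div b c 0
  have : ∀ p q : ℝ, (Real.sin p : ℂ) *
      (-2 * kbW b c p q ^ (0 + 1) +
        (0 : ℕ) * kbW b c p q ^ (0 - 1) * (b ^ 2 + c ^ 2 - kbW b c p q ^ 2))
      = (-2) * ((Real.sin p : ℂ) * kbW b c p q ^ 1) := by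
    intro p q; push_cast; ring
  simp_rw [this, intervalIntegral.integral_const_mul] at h
  unfold kbJ
  simpa using h

lemma kbJ_rec (b c : ℂ) (n : ℕ) :
    (n + 3) * kbJ b c (n + 2) = (n + 1) * (b ^ 2 + c ^ 2) * kbJ b c n := by
  have h := kb_div b c (n + 1)
  have : ∀ p q : ℝ, (Real.sin p : ℂ) *
      (-2 * kbW b c p q ^ (n + 1 + 1) +
        (n + 1 : ℕ) * kbW b c p q ^ (n + 1 - 1) * (b ^ 2 + c ^ 2 - kbW b c p q ^ 2))
      = ((n + 1) * (b ^ 2 + c ^ 2)) * ((Real.sin p : ℂ) * kbW b c p q ^ n)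
        - (n + 3) * ((Real.sin p : ℂ) * kbW b c p q ^ (n + 2)) := by
    intro p q; simp only [Nat.add_sub_cancel]; push_cast; ring
  simp_rw [this] at h
  have h2 : ∀ p : ℝ, ∫ q in (0:ℝ)..π,
      (((n + 1) * (b ^ 2 + c ^ 2)) * ((Real.sin p : ℂ) * kbW b c p q ^ n)
        - (n + 3) * ((Real.sin p : ℂ) * kbW b c p q ^ (n + 2)))
      = ((n + 1) * (b ^ 2 + c ^ 2)) * (∫ q in (0:ℝ)..π, (Real.sin p : ℂ) * kbW b c p q ^ n)
        - (n + 3) * ∫ q in (0:ℝ)..π, (Real.sin p : ℂ) * kbW b c p q ^ (n + 2) := by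
    intro p
    rw [intervalIntegral.integral_sub ((kb_q_int b c n p).const_mul _)
      ((kb_q_int b c (n+2) p).const_mul _),
      intervalIntegral.integral_const_mul (((n : ℂ) + 1) * (b ^ 2 + c ^ 2)),
      intervalIntegral.integral_const_mul ((n : ℂ) + 3)]
  simp_rw [h2] at h
  rw [intervalIntegral.integral_sub
    (((kb_inner_cont b c n).intervalIntegrable _ _).const_mul _)
    (((kb_inner_cont b c (n+2)).intervalIntegrable _ _).const_mul _),
    intervalIntegral.integral_const_mul, intervalIntegral.integral_const_mul] at h
  unfold kbJ
  linear_combination -h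

lemma kbJ_zero (b c : ℂ) : kbJ b c 0 = 2 * π := by
  unfold kbJ
  have : ∫ p in (0:ℝ)..π, (Real.sin p : ℂ) = 2 := by
    rw [intervalIntegral.integral_ofReal]; simp; norm_num
  simp only [pow_zero, mul_one, intervalIntegral.integral_const, sub_zero]
  rw [intervalIntegral.integral_smul, this]
  simp [mul_comm]

lemma kbJ_odd (b c : ℂ) (k : ℕ) : kbJ b c (2 * k + 1) = 0 := by
  induction k with
  | zero => simpa using kbJ_one b c
  | succ k ih =>
    have h := kbJ_rec b c (2 * k + 1)
    rw [ih, mul_zero] at h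
    have h3 : (((2 * k + 1 : ℕ) : ℂ) + 3) ≠ 0 := by norm_cast
    exact (mul_eq_zero.mp h).resolve_left h3

lemma kbJ_even (b c : ℂ) (k : ℕ) :
    kbJ b c (2 * k) = 2 * π * (b ^ 2 + c ^ 2) ^ k / (2 * k + 1) := by
  induction k with
  | zero => simpa using kbJ_zero b c
  | succ k ih =>
    have h := kbJ_rec b c (2 * k)
    have h3 : (((2 * k : ℕ) : ℂ) + 3) ≠ 0 := by norm_cast
    have h1 : (2 * (k : ℂ) + 1) ≠ 0 := by norm_cast
    have h4 : (2 * ((k + 1 : ℕ) : ℂ) + 1) ≠ 0 := by norm_cast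
    rw [ih] at h
    rw [show 2 * (k + 1) = 2 * k + 2 by ring]
    apply mul_left_cancel₀ h3
    rw [h]
    push_cast at *
    field_simp
    ring

lemma kbW_bound (b c : ℂ) (p q : ℝ) : ‖kbW b c p q‖ ≤ ‖c‖ + ‖b‖ := by
  unfold kbW
  have h1 : ‖(Real.cos p : ℂ)‖ ≤ 1 := by
    rw [Complex.norm_real]; exact Real.abs_cos_le_one p
  have h2 : ‖(Real.sin p : ℂ)‖ ≤ 1 := by
    rw [Complex.norm_real]; exact Real.abs_sin_le_one p
  have h3 : ‖(Real.cos q : ℂ)‖ ≤ 1 := by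
    rw [Complex.norm_real]; exact Real.abs_cos_le_one q
  refine (norm_add_le _ _).trans (add_le_add ?_ ?_)
  · rw [norm_mul]; exact mul_le_of_le_one_right (norm_nonneg _) h1
  · rw [norm_mul, norm_mul, mul_assoc]
    exact mul_le_of_le_one_right (norm_nonneg _) (mul_le_one₀ h2 (norm_nonneg _) h3)

lemma kb_term_bound (b c : ℂ) (p q : ℝ) (n : ℕ) :
    ‖(Real.sin p : ℂ) * kbW b c p q ^ n / (n.factorial : ℂ)‖ ≤
      (‖c‖ + ‖b‖) ^ n / (n.factorial : ℝ) := by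
  have h2 : ‖(Real.sin p : ℂ)‖ ≤ 1 := by
    rw [Complex.norm_real]; exact Real.abs_sin_le_one p
  rw [norm_div, norm_mul, norm_pow, Complex.norm_natCast]
  gcongr
  calc _ ≤ 1 * (‖c‖ + ‖b‖) ^ n := by
        gcongr
        exact kbW_bound b c p q
    _ = _ := one_mul _

lemma kb_hasSum (b c : ℂ) : HasSum (fun n : ℕ => kbJ b c n / (n.factorial : ℂ))
    (∫ p in (0:ℝ)..π, ∫ q in (0:ℝ)..π, (Real.sin p : ℂ) * Complex.exp (kbW b c p q)) := by
  have hs := Real.summable_pow_div_factorial (‖c‖ + ‖b‖)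
  have inner : ∀ p : ℝ, HasSum
      (fun n : ℕ => ∫ q in (0:ℝ)..π, (Real.sin p : ℂ) * kbW b c p q ^ n / (n.factorial : ℂ))
      (∫ q in (0:ℝ)..π, (Real.sin p : ℂ) * Complex.exp (kbW b c p q)) := by
    intro p
    apply intervalIntegral.hasSum_integral_of_dominated_convergence
      (fun n _ => (‖c‖ + ‖b‖) ^ n / (n.factorial : ℝ))
    · intro n
      apply Continuous.aestronglyMeasurable
      unfold kbW; fun_prop
    · intro n
      exact Filter.Eventually.of_forall fun q _ => kb_term_bound b c p q n
    · exact Filter.Eventually.of_forall fun q _ => hs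
    · exact intervalIntegrable_const
    · refine Filter.Eventually.of_forall fun q _ => ?_
      have := (NormedSpace.expSeries_div_hasSum_exp (kbW b c p q)).mul_left (Real.sin p : ℂ)
      rw [← Complex.exp_eq_exp_ℂ] at this
      simpa [mul_div_assoc] using this
  have e : (fun n : ℕ => kbJ b c n / (n.factorial : ℂ)) = fun n : ℕ => ∫ p in (0:ℝ)..π,
      ∫ q in (0:ℝ)..π, (Real.sin p : ℂ) * kbW b c p q ^ n / (n.factorial : ℂ) := by
    funext n
    simp_rw [intervalIntegral.integral_div]
    rfl
  rw [e]
  apply intervalIntegral.hasSum_integral_of_dominated_convergence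
    (fun n _ => (‖c‖ + ‖b‖) ^ n / (n.factorial : ℝ) * |π - 0|)
  · intro n
    apply Continuous.aestronglyMeasurable
    simp_rw [intervalIntegral.integral_div]
    exact (kb_inner_cont b c n).div_const _
  · intro n
    refine Filter.Eventually.of_forall fun p _ => ?_
    exact intervalIntegral.norm_integral_le_of_norm_le_const fun q _ => kb_term_bound b c p q n
  · exact Filter.Eventually.of_forall fun q _ => hs.mul_right _
  · exact intervalIntegrable_const
  · exact Filter.Eventually.of_forall fun p _ => inner p

lemma kb_main (b c s : ℂ) (hs : s ≠ 0) (h : b ^ 2 + c ^ 2 = - s ^ 2) :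
    ∫ p in (0:ℝ)..π, ∫ q in (0:ℝ)..π, (Real.sin p : ℂ) * Complex.exp (kbW b c p q)
      = 2 * π * (Complex.sin s / s) := by
  apply (kb_hasSum b c).unique
  have h1 := (Complex.hasSum_sin s).mul_left (2 * π / s)
  have h2 : HasSum (fun k : ℕ => kbJ b c (2 * k) / ((2 * k).factorial : ℂ))
      (2 * π * (Complex.sin s / s)) := by
    have ef : (fun k : ℕ => kbJ b c (2 * k) / ((2 * k).factorial : ℂ)) = fun k : ℕ =>
        2 * π / s * ((-1) ^ k * s ^ (2 * k + 1) / ((2 * k + 1).factorial : ℂ)) := by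
      funext k
      rw [kbJ_even, h, Nat.factorial_succ, neg_pow, ← pow_mul, pow_succ]
      have : (2 * (k : ℂ) + 1) ≠ 0 := by norm_cast
      have : ((2 * k).factorial : ℂ) ≠ 0 := by exact_mod_cast Nat.factorial_ne_zero _
      push_cast
      field_simp
    have ev : 2 * π * (Complex.sin s / s) = 2 * π / s * Complex.sin s := by ring
    rw [ef, ev]
    exact h1
  have h3 : HasSum (fun k : ℕ => kbJ b c (2 * k + 1) / ((2 * k + 1).factorial : ℂ)) 0 := by
    simp_rw [kbJ_odd, zero_div]
    exact hasSum_zero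
  have h4 := HasSum.even_add_odd (f := fun n : ℕ => kbJ b c n / (n.factorial : ℂ)) h2 h3
  rwa [add_zero] at h4

lemma besselI0_cont : Continuous besselI0 := by
  unfold besselI0
  refine continuous_const.mul ?_
  apply intervalIntegral.continuous_parametric_intervalIntegral_of_continuous'
  simp only [Function.uncurry_def]; fun_prop

/-- Exact (centered) Fourier transform of the Kaiser–Bessel window for `|ω| > 2b/δ`:
`∫₀^δ φ'(t) e^{iω(t-δ/2)} dt = (b / sinh b) · sin s / s` with `s = √((δω/2)² − b²)`. -/
theorem stmt0 (b δ : ℝ) (hb : 0 < b) (hδ : 0 < δ) (ω : ℝ)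
    (hω : |ω| > 2 * b / δ) :
    (∫ t in (0:ℝ)..δ, (kbDeriv b δ t : ℂ) * Complex.exp (Complex.I * ω * (t - δ / 2))) =
      (((b / Real.sinh b) *
        (Real.sin (Real.sqrt ((δ * ω / 2) ^ 2 - b ^ 2)) /
          Real.sqrt ((δ * ω / 2) ^ 2 - b ^ 2)) : ℝ) : ℂ) := by
  have hδ0 := hδ.ne'
  have hsh : Real.sinh b ≠ 0 := (Real.sinh_pos_iff.mpr hb).ne'
  set a : ℝ := δ * ω / 2 with ha
  have hpos : 0 < a ^ 2 - b ^ 2 := by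
    have h1 : b < |a| := by
      rw [ha, abs_div, abs_mul, abs_of_pos hδ, abs_of_pos (by norm_num : (0:ℝ) < 2)]
      rw [gt_iff_lt, div_lt_iff₀ hδ] at hω
      linarith
    have := sq_abs a
    nlinarith
  set s : ℝ := Real.sqrt (a ^ 2 - b ^ 2) with hs
  have hs0 : s ≠ 0 := (Real.sqrt_pos.mpr hpos).ne'
  have hs2 : s ^ 2 = a ^ 2 - b ^ 2 := Real.sq_sqrt hpos.le
  have hI : (b : ℂ) ^ 2 + (-(Complex.I * a)) ^ 2 = -(s : ℂ) ^ 2 := by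
    have : (s : ℂ) ^ 2 = (a : ℂ) ^ 2 - (b : ℂ) ^ 2 := by exact_mod_cast hs2
    rw [neg_sq, mul_pow, Complex.I_sq, this]; ring
  have hm := kb_main b (-(Complex.I * a)) s (by exact_mod_cast hs0) hI
  set g : ℝ → ℂ := fun t =>
    (((b / (δ * Real.sinh b)) * besselI0 (b * Real.sqrt (1 - (2 * t / δ - 1) ^ 2)) : ℝ) : ℂ) *
      Complex.exp (Complex.I * ω * (t - δ / 2)) with hg
  have hgc : Continuous g := by
    have := besselI0_cont
    simp only [hg]
    fun_prop
  have e1 : (∫ t in (0:ℝ)..δ, (kbDeriv b δ t : ℂ) * Complex.exp (Complex.I * ω * (t - δ / 2)))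
      = ∫ t in (0:ℝ)..δ, g t := by
    apply intervalIntegral.integral_congr
    intro t ht
    rw [Set.uIcc_of_le hδ.le] at ht
    simp only [hg, kbDeriv, if_pos (show 0 ≤ t ∧ t ≤ δ from ht)]
  have hf : ∀ p : ℝ, HasDerivAt (fun p : ℝ => δ / 2 * (1 - Real.cos p)) (δ / 2 * Real.sin p) p := by
    intro p
    simpa using ((Real.hasDerivAt_cos p).const_sub 1).const_mul (δ / 2)
  have e2 := intervalIntegral.integral_deriv_smul_comp (a := 0) (b := π) (g := g)
    (fun p _ => hf p) (by fun_prop) hgc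
  have e3 : (∫ t in (0:ℝ)..δ, g t) =
      ∫ p in (0:ℝ)..π, (δ / 2 * Real.sin p) • g (δ / 2 * (1 - Real.cos p)) := by
    have r0 : δ / 2 * (1 - Real.cos 0) = 0 := by simp
    have r1 : δ / 2 * (1 - Real.cos π) = δ := by simp; ring
    rw [r0, r1] at e2
    rw [← e2]; rfl
  rw [e1, e3]
  have e4 : ∀ p ∈ Set.uIcc 0 π, (δ / 2 * Real.sin p) • g (δ / 2 * (1 - Real.cos p)) =
      ((b / (2 * π * Real.sinh b) : ℝ) : ℂ) * ∫ q in (0:ℝ)..π,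
        (Real.sin p : ℂ) * Complex.exp (kbW b (-(Complex.I * a)) p q) := by
    intro p hp
    rw [Set.uIcc_of_le Real.pi_pos.le] at hp
    have hsin := Real.sin_nonneg_of_mem_Icc hp
    have q1 : Real.sqrt (1 - (2 * (δ / 2 * (1 - Real.cos p)) / δ - 1) ^ 2) = Real.sin p := by
      rw [show 1 - (2 * (δ / 2 * (1 - Real.cos p)) / δ - 1) ^ 2 = Real.sin p ^ 2 by
        rw [Real.sin_sq]; field_simp; ring]
      exact Real.sqrt_sq hsin
    have q2 : Complex.I * ω * (((δ / 2 * (1 - Real.cos p) : ℝ) : ℂ) - δ / 2) =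
        -(Complex.I * a) * Real.cos p := by
      rw [ha]; push_cast; ring
    have q3 : ∀ q : ℝ, (Real.sin p : ℂ) * Complex.exp (kbW b (-(Complex.I * a)) p q) =
        ((Real.sin p : ℂ) * Complex.exp (-(Complex.I * a) * Real.cos p)) *
          ((Real.exp (b * Real.sin p * Real.cos q) : ℝ) : ℂ) := by
      intro q
      unfold kbW
      rw [Complex.exp_add]; push_cast; ring
    simp_rw [q3]
    rw [intervalIntegral.integral_const_mul, intervalIntegral.integral_ofReal]
    simp only [hg]
    rw [q1, q2, besselI0, Complex.real_smul]
    have hπ : (π : ℂ) ≠ 0 := by exact_mod_cast Real.pi_ne_zero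
    have hδc : (δ : ℂ) ≠ 0 := by exact_mod_cast hδ0
    have hsc : ((Real.sinh b : ℝ) : ℂ) ≠ 0 := by exact_mod_cast hsh
    simp only [Complex.ofReal_mul, Complex.ofReal_div, Complex.ofReal_one, Complex.ofReal_ofNat]
    field_simp
  rw [intervalIntegral.integral_congr e4, intervalIntegral.integral_const_mul, hm]
  have hπ : (π : ℂ) ≠ 0 := by exact_mod_cast Real.pi_ne_zero
  have hsc : ((Real.sinh b : ℝ) : ℂ) ≠ 0 := by exact_mod_cast hsh
  have hs1 : (s : ℂ) ≠ 0 := by exact_mod_cast hs0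
  simp only [Complex.ofReal_mul, Complex.ofReal_div, Complex.ofReal_ofNat, Complex.ofReal_sin]
  field_simp
end

section
/- Let δ > 0, 0 < ε < 1, b = ln(1/ε), and let φ be the Kaiser–Bessel blending function: φ(t) = ∫₀^t φ'(τ) dτ where φ'(τ) = (b/(δ sinh b)) I₀(b√(1 − (2τ/δ − 1)²)) for 0 ≤ τ ≤ δ and φ'(τ) = 0 otherwise, with I₀(x) = (1/π)∫₀^π e^{x cos θ} dθ. Set A = 2√3 + δ. Fix K₀ > 0, P > 0 and θ > 1, and set K = K₀ + 2b/(δ√(1 − 1/θ²)). Then there exists a constant C > 0, depending only on δ, ε, K₀, P and θ (and not on M, the source locations, the signals, k, or t), such that the following holds: for every M ∈ ℕ, every choice of points y₁, …, y_M ∈ ℝ³, and every choice of functions σ₁, …, σ_M ∈ L¹(ℝ) ∩ L²(ℝ) with σ_j(t) = 0 for t ≤ 0, ‖σ_j‖_{L¹} ≤ P, and |σ̂_j(ω)| ≤ ε/ω² for all |ω| > K₀ (where σ̂_j(ω) = ∫_ℝ σ_j(t) e^{iωt} dt), defining S(k, τ) = Σ_{j=1}^M σ_j(τ) e^{i⟨k,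 y_j⟩} and α(k, t) = ∫_{t−A}^{t} (sin(‖k‖(t − τ))/‖k‖) · S(k, τ) · φ(t − τ) · φ(A − t + τ) dτ, one has |α(k, t)| ≤ C · M · ε / ‖k‖³ for every t ≥ 0 and every k ∈ ℝ³ with ‖k‖ > K. -/
open Real MeasureTheory

/-- The Kaiser–Bessel blending function `φ(t) = ∫₀^t φ'(τ) dτ`. -/
noncomputable def kbBlend (b δ t : ℝ) : ℝ := ∫ τ in (0:ℝ)..t, kbDeriv b δ τ

lemma mono_diff {G : ℝ → ℝ} (hG : Monotone G) {B h : ℝ} (h0 : ∀ x, 0 ≤ G x)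
    (hB : ∀ x, G x ≤ B) (hh : 0 < h) :
    Integrable (fun x => G x - G (x - h)) ∧ (∫ x, (G x - G (x - h))) ≤ h * B := by
  have hG2 : Monotone (fun x => G (x - h)) := fun a b hab => hG (by linarith)
  have hint : ∀ a b : ℝ, IntervalIntegrable G volume a b := fun a b => hG.intervalIntegrable
  have hint2 : ∀ a b : ℝ, IntervalIntegrable (fun x => G (x - h)) volume a b :=
    fun a b => hG2.intervalIntegrable
  have key : ∀ a b : ℝ, (∫ x in a..b, (G x - G (x - h))) ≤ h * B := by
    intro a b
    rw [intervalIntegral.integral_sub (hint _ _) (hint2 _ _),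
      intervalIntegral.integral_comp_sub_right (fun x => G x) h]
    have e1 := intervalIntegral.integral_add_adjacent_intervals (hint (a-h) a) (hint a b)
    have e2 := intervalIntegral.integral_add_adjacent_intervals (hint (a-h) (b-h)) (hint (b-h) b)
    have p1 : 0 ≤ ∫ x in (a-h)..a, G x :=
      intervalIntegral.integral_nonneg (by linarith) (fun x _ => h0 x)
    have p2 : (∫ x in (b-h)..b, G x) ≤ ∫ x in (b-h)..b, B :=
      intervalIntegral.integral_mono_on (by linarith) (hint _ _) (by simp) (fun x _ => hB x)
    simp at p2
    linarith
  have hnn : ∀ x, 0 ≤ G x - G (x - h) := fun x => by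
    have := hG (show x - h ≤ x by linarith); linarith
  have hI : Integrable (fun x => G x - G (x - h)) := by
    refine integrable_of_intervalIntegral_norm_bounded (l := Filter.atTop)
      (a := fun n : ℝ => -n) (b := fun n : ℝ => n) (h * B) ?_
      Filter.tendsto_neg_atTop_atBot Filter.tendsto_id ?_
    · intro n
      by_cases hn : -n ≤ n
      · exact (intervalIntegrable_iff_integrableOn_Ioc_of_le hn).1 ((hint _ _).sub (hint2 _ _))
      · rw [Set.Ioc_eq_empty (by linarith)]; exact integrableOn_empty
    · refine Filter.Eventually.of_forall fun n => ?_
      simp_rw [Real.norm_of_nonneg (hnn _)]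
      exact key _ _
  refine ⟨hI, ?_⟩
  exact le_of_tendsto (intervalIntegral_tendsto_integral hI
    Filter.tendsto_neg_atTop_atBot (Filter.tendsto_id (α := ℝ)))
    (Filter.Eventually.of_forall fun n => key _ _)

lemma second_diff {f : ℝ → ℝ} (hf : Monotone f) {c h : ℝ} (h0 : ∀ x, 0 ≤ f x)
    (hc : ∀ x, f x ≤ c) (hh : 0 < h) {F : ℝ → ℝ} (hF : ∀ x, F x = ∫ τ in (0:ℝ)..x, f τ) :
    (∀ x, 0 ≤ F (x + h) - 2 * F x + F (x - h)) ∧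
    Integrable (fun x => F (x + h) - 2 * F x + F (x - h)) ∧
    (∫ x, (F (x + h) - 2 * F x + F (x - h))) ≤ c * h ^ 2 := by
  have hint : ∀ a b : ℝ, IntervalIntegrable f volume a b := fun a b => hf.intervalIntegrable
  have hG : ∀ x, F (x + h) - F x = ∫ u in (0:ℝ)..h, f (x + u) := by
    intro x
    rw [hF, hF, intervalIntegral.integral_interval_sub_left (hint _ _) (hint _ _),
      intervalIntegral.integral_comp_add_left (fun u => f u) x]
    simp
  have hfx : ∀ x a b : ℝ, IntervalIntegrable (fun u => f (x + u)) volume a b := fun x a b =>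
    Monotone.intervalIntegrable (fun a b hab => hf (by linarith))
  have hmono : Monotone (fun x => F (x + h) - F x) := by
    intro x y hxy
    simp only [hG]
    exact intervalIntegral.integral_mono_on hh.le (hfx _ _ _) (hfx _ _ _)
      (fun u _ => hf (by linarith))
  have hnn : ∀ x, 0 ≤ F (x + h) - F x := fun x => by
    rw [hG]; exact intervalIntegral.integral_nonneg hh.le (fun u _ => h0 _)
  have hle : ∀ x, F (x + h) - F x ≤ c * h := fun x => by
    rw [hG]
    have := intervalIntegral.integral_mono_on hh.le (hfx x 0 h) (g := fun _ => c) (by simp)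
      (fun u _ => hc _)
    simp only [intervalIntegral.integral_const, sub_zero, smul_eq_mul] at this
    linarith
  have := mono_diff hmono hnn hle hh
  have e : ∀ x, F (x + h) - F x - (F (x - h + h) - F (x - h)) = F (x + h) - 2 * F x + F (x - h) := by
    intro x; rw [sub_add_cancel]; ring
  simp only [e] at this
  refine ⟨fun x => ?_, this.1, this.2.trans (le_of_eq (by ring))⟩
  rw [← e]
  have := hmono (show x - h ≤ x by linarith)
  simp only at this
  linarith

lemma besselI0_mono {x y : ℝ} (hx : 0 ≤ x) (hxy : x ≤ y) : besselI0 x ≤ besselI0 y := by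
  have hc : ∀ x, besselI0 x = (1 / π) * ∫ θ in (0:ℝ)..π, Real.cosh (x * Real.cos θ) := by
    intro x
    unfold besselI0
    congr 1
    have e : (∫ θ in (0:ℝ)..π, Real.exp (x * Real.cos θ)) =
        ∫ θ in (0:ℝ)..π, Real.exp (-(x * Real.cos θ)) := by
      have := intervalIntegral.integral_comp_sub_left
        (fun θ => Real.exp (x * Real.cos θ)) π (a := 0) (b := π)
      simp only [Real.cos_pi_sub, sub_self, sub_zero, mul_neg] at this
      exact this.symm
    have h1 : IntervalIntegrable (fun θ => Real.exp (x * Real.cos θ)) volume 0 π :=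
      (by fun_prop : Continuous _).intervalIntegrable _ _
    have h2 : IntervalIntegrable (fun θ => Real.exp (-(x * Real.cos θ))) volume 0 π :=
      (by fun_prop : Continuous _).intervalIntegrable _ _
    simp_rw [Real.cosh_eq]
    rw [intervalIntegral.integral_div, intervalIntegral.integral_add h1 h2, ← e]
    ring
  rw [hc, hc]
  refine mul_le_mul_of_nonneg_left ?_ (by positivity)
  refine intervalIntegral.integral_mono_on Real.pi_pos.le
    ((by fun_prop : Continuous _).intervalIntegrable _ _)
    ((by fun_prop : Continuous _).intervalIntegrable _ _) (fun θ _ => ?_)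
  rw [Real.cosh_le_cosh, abs_mul, abs_mul]
  gcongr

lemma besselI0_nonneg (x : ℝ) : 0 ≤ besselI0 x := by
  unfold besselI0
  refine mul_nonneg (by positivity)
    (intervalIntegral.integral_nonneg Real.pi_pos.le (fun u _ => (Real.exp_pos _).le))

lemma kb_decomp {b δ : ℝ} (hb : 0 < b) (hδ : 0 < δ) : ∃ (c : ℝ) (f g : ℝ → ℝ), 0 ≤ c ∧
    Monotone f ∧ Monotone g ∧ (∀ x, 0 ≤ f x) ∧ (∀ x, 0 ≤ g x) ∧ (∀ x, f x ≤ c) ∧ (∀ x, g x ≤ c) ∧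
    (∀ x, kbDeriv b δ x = f x - g x) ∧ (∀ x, 0 ≤ kbDeriv b δ x) := by
  set G : ℝ → ℝ := fun t =>
    (b / (δ * Real.sinh b)) * besselI0 (b * Real.sqrt (1 - (2 * t / δ - 1) ^ 2)) with hG
  have hs : 0 < Real.sinh b := Real.sinh_pos_iff.2 hb
  have hpre : 0 ≤ b / (δ * Real.sinh b) := by positivity
  have hG0 : ∀ t, 0 ≤ G t := fun t => mul_nonneg hpre (besselI0_nonneg _)
  have hm : ∀ x y, (2 * y / δ - 1) ^ 2 ≤ (2 * x / δ - 1) ^ 2 → G x ≤ G y := by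
    intro x y hxy
    refine mul_le_mul_of_nonneg_left (besselI0_mono (by positivity) ?_) hpre
    gcongr
  have hup : ∀ x y, x ≤ y → y ≤ δ / 2 → G x ≤ G y := by
    intro x y h1 h2
    apply hm
    have a1 : 2 * y / δ ≤ 1 := by rw [div_le_one hδ]; linarith
    have a2 : 2 * x / δ ≤ 2 * y / δ := by gcongr
    nlinarith
  have hdn : ∀ x y, x ≤ y → δ / 2 ≤ x → G y ≤ G x := by
    intro x y h1 h2
    apply hm
    have a1 : 1 ≤ 2 * x / δ := by rw [one_le_div hδ]; linarith
    have a2 : 2 * x / δ ≤ 2 * y / δ := by gcongr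
    nlinarith
  have htop : ∀ x, G x ≤ G (δ / 2) := fun x => by
    rcases le_total x (δ / 2) with h | h
    · exact hup _ _ h le_rfl
    · exact hdn _ _ h le_rfl
  have hkb : ∀ t, kbDeriv b δ t = if 0 ≤ t ∧ t ≤ δ then G t else 0 := fun t => rfl
  refine ⟨G (δ / 2), fun t => if t < 0 then 0 else G (min t (δ / 2)),
    fun t => if t ≤ δ then G (δ / 2) - G (max t (δ / 2)) else G (δ / 2), hG0 _, ?_, ?_, ?_, ?_,
    ?_, ?_, ?_, ?_⟩
  · intro x y hxy
    simp only
    split_ifs with h1 h2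
    · exact le_rfl
    · exact hG0 _
    · linarith
    · exact hup _ _ (min_le_min_right _ hxy) (min_le_right _ _)
  · intro x y hxy
    simp only
    split_ifs with h1 h2
    · have := hdn _ _ (max_le_max_right (δ/2) hxy) (le_max_right _ _)
      linarith
    · linarith [hG0 (max x (δ/2))]
    · linarith
    · exact le_rfl
  · intro x; simp only; split_ifs
    · exact le_rfl
    · exact hG0 _
  · intro x; simp only; split_ifs
    · linarith [htop (max x (δ/2))]
    · exact hG0 _
  · intro x; simp only; split_ifs
    · exact hG0 _
    · exact htop _
  · intro x; simp only; split_ifs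
    · linarith [hG0 (max x (δ/2))]
    · exact le_rfl
  · intro x
    rw [hkb]
    rcases lt_or_ge x 0 with h | h
    · have : x ≤ δ := by linarith
      simp [h, this, not_le.2 h, max_eq_right (show x ≤ δ / 2 by linarith)]
    · rcases le_or_gt x δ with h' | h'
      · rcases le_total x (δ/2) with h2 | h2
        · simp [h, h', not_lt.2 h, h2]
        · simp [h, h', not_lt.2 h, h2]
      · simp [not_le.2 h', not_lt.2 h, min_eq_right (show δ / 2 ≤ x by linarith)]
  · intro x; rw [hkb]; split_ifs
    · exact hG0 _
    · exact le_rfl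

/-- Properties of the blend. -/
lemma kb_props {b δ : ℝ} (hb : 0 < b) (hδ : 0 < δ) : ∃ c : ℝ, 0 ≤ c ∧
    Monotone (kbBlend b δ) ∧ Continuous (kbBlend b δ) ∧ (∀ x, x ≤ 0 → kbBlend b δ x = 0) ∧
    (∀ x, 0 ≤ kbBlend b δ x) ∧ (∀ x, kbBlend b δ x ≤ c * δ) ∧
    (∀ x h, 0 < h → kbBlend b δ x - kbBlend b δ (x - h) ≤ c * h) ∧
    (∀ h, 0 < h → Integrable (fun x => |kbBlend b δ (x + h) - 2 * kbBlend b δ x +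
        kbBlend b δ (x - h)|) ∧
      (∫ x, |kbBlend b δ (x + h) - 2 * kbBlend b δ x + kbBlend b δ (x - h)|) ≤ 2 * c * h ^ 2) := by
  obtain ⟨c, f, g, hc, hf, hg, hf0, hg0, hfc, hgc, hk, hk0⟩ := kb_decomp hb hδ
  have hif : ∀ a b : ℝ, IntervalIntegrable f volume a b := fun a b => hf.intervalIntegrable
  have hig : ∀ a b : ℝ, IntervalIntegrable g volume a b := fun a b => hg.intervalIntegrable
  have hkeq : kbDeriv b δ = fun x => f x - g x := funext hk
  have hik : ∀ x y : ℝ, IntervalIntegrable (kbDeriv b δ) volume x y := fun x y => by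
    rw [hkeq]; exact (hif _ _).sub (hig _ _)
  have hkc : ∀ x, kbDeriv b δ x ≤ c := fun x => by rw [hk]; linarith [hfc x, hg0 x]
  have hsub : ∀ x y, kbBlend b δ y - kbBlend b δ x = ∫ τ in x..y, kbDeriv b δ τ := fun x y =>
    intervalIntegral.integral_interval_sub_left (hik _ _) (hik _ _)
  have hmono : Monotone (kbBlend b δ) := fun x y hxy => by
    have : 0 ≤ kbBlend b δ y - kbBlend b δ x := by
      rw [hsub]; exact intervalIntegral.integral_nonneg hxy (fun u _ => hk0 u)
    linarith
  have hlip : ∀ x y, x ≤ y → kbBlend b δ y - kbBlend b δ x ≤ c * (y - x) := fun x y hxy => by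
    rw [hsub]
    have := intervalIntegral.integral_mono_on hxy (hik x y) (g := fun _ => c) (by simp)
      (fun u _ => hkc _)
    simp at this
    linarith
  have hz : ∀ x, x ≤ 0 → kbBlend b δ x = 0 := fun x hx => by
    have e : kbBlend b δ x = -∫ τ in x..(0:ℝ), kbDeriv b δ τ := intervalIntegral.integral_symm _ _
    rw [e, intervalIntegral.integral_of_le hx, integral_Ioc_eq_integral_Ioo,
      setIntegral_congr_fun (g := fun _ => (0:ℝ)) measurableSet_Ioo]
    · simp
    · intro u hu
      simp [kbDeriv, not_le.2 hu.2]
  have hnn : ∀ x, 0 ≤ kbBlend b δ x := fun x => by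
    rcases le_total x 0 with h | h
    · rw [hz x h]
    · rw [← hz 0 le_rfl]; exact hmono h
  have hle1 : ∀ x, x ≤ δ → kbBlend b δ x ≤ c * δ := fun x hx => by
    have := hlip 0 δ hδ.le
    rw [hz 0 le_rfl] at this
    linarith [hmono hx]
  have hle : ∀ x, kbBlend b δ x ≤ c * δ := fun x => by
    rcases le_total x δ with h | h
    · exact hle1 x h
    · have : kbBlend b δ x - kbBlend b δ δ = 0 := by
        rw [hsub, intervalIntegral.integral_of_le h,
          setIntegral_congr_fun (g := fun _ => (0:ℝ)) measurableSet_Ioc]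
        · simp
        · intro u hu
          simp [kbDeriv, not_le.2 hu.1]
      linarith [hle1 δ le_rfl]
  have hcont : Continuous (kbBlend b δ) := by
    have : LipschitzWith c.toNNReal (kbBlend b δ) := by
      refine LipschitzWith.of_le_add_mul _ fun x y => ?_
      rw [Real.coe_toNNReal _ hc, Real.dist_eq]
      rcases le_total x y with h | h
      · have := hmono h
        have : 0 ≤ c * |x - y| := by positivity
        linarith
      · have := hlip y x h
        rw [abs_of_nonneg (by linarith)]; linarith
    exact this.continuous
  refine ⟨c, hc, hmono, hcont, hz, hnn, hle, fun x h hh => ?_, fun h hh => ?_⟩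
  · have := hlip (x - h) x (by linarith)
    linarith
  · obtain ⟨n1, i1, l1⟩ := second_diff hf hf0 hfc hh (F := fun x => ∫ τ in (0:ℝ)..x, f τ) (fun _ => rfl)
    obtain ⟨n2, i2, l2⟩ := second_diff hg hg0 hgc hh (F := fun x => ∫ τ in (0:ℝ)..x, g τ) (fun _ => rfl)
    have hd : ∀ x, kbBlend b δ x = (∫ τ in (0:ℝ)..x, f τ) - ∫ τ in (0:ℝ)..x, g τ := fun x => by
      rw [← intervalIntegral.integral_sub (hif _ _) (hig _ _), ← hkeq]; rfl
    have hb : ∀ x, |kbBlend b δ (x + h) - 2 * kbBlend b δ x + kbBlend b δ (x - h)| ≤ 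
      ((∫ τ in (0:ℝ)..(x+h), f τ) - 2 * (∫ τ in (0:ℝ)..x, f τ) + ∫ τ in (0:ℝ)..(x-h), f τ) +
      ((∫ τ in (0:ℝ)..(x+h), g τ) - 2 * (∫ τ in (0:ℝ)..x, g τ) + ∫ τ in (0:ℝ)..(x-h), g τ) := by
      intro x
      rw [hd, hd, hd, abs_le]
      constructor <;> linarith [n1 x, n2 x]
    have hI : Integrable (fun x => |kbBlend b δ (x + h) - 2 * kbBlend b δ x +
        kbBlend b δ (x - h)|) := by
      refine (i1.add i2).mono' (by fun_prop) (Filter.Eventually.of_forall fun x => ?_)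
      rw [Real.norm_eq_abs, abs_abs]
      exact hb x
    refine ⟨hI, ?_⟩
    refine (integral_mono hI (i1.add i2) hb).trans ?_
    rw [integral_add' i1 i2]
    linarith

open scoped FourierTransform in
lemma fourier_decay {W : ℝ → ℂ} (hW : Integrable W) {N B : ℝ} (hB0 : 0 ≤ B)
    (hN : (∫ x, ‖W x‖) ≤ N)
    (hB : ∀ h : ℝ, 0 < h → (∫ x, ‖W (x + h) - 2 * W x + W (x - h)‖) ≤ B * h ^ 2) (ξ : ℝ) :
    ‖𝓕 W ξ‖ ≤ (N + B) * (1 + ξ ^ 2)⁻¹ := by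
  have b1 : ‖𝓕 W ξ‖ ≤ N :=
    (VectorFourier.norm_fourierIntegral_le_integral_norm _ _ _ _ _).trans hN
  rw [← div_eq_mul_inv, le_div_iff₀ (by positivity)]
  suffices h2 : ‖𝓕 W ξ‖ * ξ ^ 2 ≤ B by linarith
  rcases eq_or_ne ξ 0 with rfl | hξ
  · simpa using hB0
  set h : ℝ := 1 / (2 * |ξ|) with hh
  have hξ' : 0 < |ξ| := abs_pos.2 hξ
  have hpos : 0 < h := by positivity
  set E : ℝ → ℂ := fun v => Complex.exp (↑(-2 * π * v * ξ) * Complex.I) with hE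
  have hEc : Continuous E := by rw [hE]; fun_prop
  have hEn : ∀ v, ‖E v‖ = 1 := fun v => Complex.norm_exp_ofReal_mul_I _
  have hph : ∀ v, E (v + h) = - E v ∧ E (v - h) = - E v := by
    intro v
    have k1 : h * ξ = 1 / 2 ∨ h * ξ = - (1 / 2) := by
      rcases abs_cases ξ with ⟨h1, _⟩ | ⟨h1, _⟩
      · left; rw [hh, h1]; field_simp
      · right; rw [hh, h1]; field_simp
    have e1 : ∀ s : ℝ, (s * ξ = 1 / 2 ∨ s * ξ = - (1 / 2)) → E (v + s) = - E v := by
      intro s hs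
      have : (↑(-2 * π * (v + s) * ξ) * Complex.I : ℂ) =
          ↑(-2 * π * v * ξ) * Complex.I + ↑(-2 * π * (s * ξ)) * Complex.I := by
        push_cast; ring
      simp only [hE]
      rw [this, Complex.exp_add]
      rcases hs with hs | hs
      · rw [hs]
        have : ((↑(-2 * π * (1 / 2)) : ℝ) : ℂ) * Complex.I = -(π * Complex.I) := by
          push_cast; ring
        rw [this, Complex.exp_neg, Complex.exp_pi_mul_I]; norm_num
      · rw [hs]
        have : ((↑(-2 * π * (-(1 / 2))) : ℝ) : ℂ) * Complex.I = (π * Complex.I) := by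
          push_cast; ring
        rw [this, Complex.exp_pi_mul_I]; norm_num
    refine ⟨e1 h k1, ?_⟩
    rw [sub_eq_add_neg]
    apply e1
    rcases k1 with k1 | k1
    · right; linarith
    · left; linarith
  have hJ : 𝓕 W ξ = ∫ v, E v * W v := by
    rw [Real.fourier_real_eq_integral_exp_smul]; simp [hE]
  have hmul : ∀ {f : ℝ → ℂ}, Integrable f → Integrable (fun v => E v * f v) := fun {f} hf =>
    hf.bdd_mul (c := 1) hEc.aestronglyMeasurable
      (Filter.Eventually.of_forall fun v => (hEn v).le)
  have s1 : (∫ v, E v * W (v + h)) = - ∫ v, E v * W v := by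
    rw [← integral_neg, ← integral_add_right_eq_self (fun v => -(E v * W v)) h]
    refine integral_congr_ae (Filter.Eventually.of_forall fun v => ?_)
    simp only [(hph v).1]; ring
  have s2 : (∫ v, E v * W (v - h)) = - ∫ v, E v * W v := by
    rw [← integral_neg, ← integral_sub_right_eq_self (fun v => -(E v * W v)) h]
    refine integral_congr_ae (Filter.Eventually.of_forall fun v => ?_)
    simp only [(hph v).2]; ring
  have i1 := hmul (hW.comp_add_right h)
  have i2 := hmul (hW.comp_sub_right h)
  have i3 := hmul hW
  have s3 : (∫ v, E v * (W (v + h) - 2 * W v + W (v - h))) = -4 * 𝓕 W ξ := by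
    have : ∀ v, E v * (W (v + h) - 2 * W v + W (v - h)) =
        (E v * W (v + h) - 2 * (E v * W v)) + E v * W (v - h) := fun v => by ring
    simp_rw [this]
    rw [integral_add (f := fun v => E v * W (v + h) - 2 * (E v * W v)) (i1.sub (i3.const_mul 2)) i2, integral_sub i1 (i3.const_mul 2),
      integral_const_mul, s1, s2, hJ]
    ring
  have s4 : 4 * ‖𝓕 W ξ‖ ≤ B * h ^ 2 := by
    calc 4 * ‖𝓕 W ξ‖ = ‖∫ v, E v * (W (v + h) - 2 * W v + W (v - h))‖ := by
          rw [s3, norm_mul]; norm_num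
      _ ≤ ∫ v, ‖E v * (W (v + h) - 2 * W v + W (v - h))‖ := norm_integral_le_integral_norm _
      _ = ∫ v, ‖W (v + h) - 2 * W v + W (v - h)‖ := by simp_rw [norm_mul, hEn, one_mul]
      _ ≤ _ := hB h hpos
  have s5 : h ^ 2 * ξ ^ 2 = 1 / 4 := by
    rw [hh, ← sq_abs ξ]; field_simp; norm_num
  nlinarith [mul_le_mul_of_nonneg_right s4 (sq_nonneg ξ)]

open scoped FourierTransform in
lemma conv_bound {W g : ℝ → ℂ} (hW : Integrable W) (hWc : Continuous W) (hg : Integrable g)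
    {B D : ℝ} (hB : ∀ ξ, ‖𝓕 W ξ‖ ≤ B * (1 + ξ ^ 2)⁻¹)
    (hD : ∀ ξ, ‖𝓕 g ξ‖ ≤ D * (1 + ξ ^ 2)⁻¹) (η : ℝ) :
    ‖∫ v, W v * (Complex.exp (↑(-2 * π * v * η) * Complex.I) * g v)‖
      ≤ 4 * π * B * D * (1 + η ^ 2)⁻¹ := by
  have hB0 : 0 ≤ B := by have := (norm_nonneg _).trans (hB 0); simpa using this
  have hD0 : 0 ≤ D := by have := (norm_nonneg _).trans (hD 0); simpa using this
  have hcont : ∀ {f : ℝ → ℂ}, Integrable f → Continuous (𝓕 f) := fun {f} hf =>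
    VectorFourier.fourierIntegral_continuous Real.continuous_fourierChar
      (by exact continuous_inner) hf
  have hFW : Integrable (𝓕 W) :=
    (integrable_inv_one_add_sq.const_mul B).mono' (hcont hW).aestronglyMeasurable
      (Filter.Eventually.of_forall hB)
  set g' : ℝ → ℂ := fun v => Complex.exp (↑(-2 * π * v * η) * Complex.I) * g v with hg'
  have hg'i : Integrable g' := hg.bdd_mul (c := 1) (by fun_prop)
      (Filter.Eventually.of_forall fun v => (Complex.norm_exp_ofReal_mul_I _).le)
  have hFg' : ∀ ξ, 𝓕 g' ξ = 𝓕 g (ξ + η) := by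
    intro ξ
    rw [Real.fourier_real_eq_integral_exp_smul, Real.fourier_real_eq_integral_exp_smul]
    refine integral_congr_ae (Filter.Eventually.of_forall fun v => ?_)
    simp only [hg', smul_eq_mul]
    rw [← mul_assoc, ← Complex.exp_add]
    congr 2
    push_cast; ring
  set f : ℝ → ℂ := fun ξ => 𝓕 W (-ξ) with hf
  have hfi : Integrable f := hFW.comp_neg
  have hFf : 𝓕 f = W := by
    rw [hf, ← Real.fourierInv_eq_fourier_comp_neg]
    exact hWc.fourierInv_fourier_eq hW hFW
  have key : (∫ v, W v * g' v) = ∫ ξ, f ξ * 𝓕 g' ξ := by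
    have := VectorFourier.integral_fourierIntegral_smul_eq_flip (L := innerₗ ℝ) (μ := volume)
      (ν := volume) Real.continuous_fourierChar (by exact continuous_inner) hfi hg'i
    rw [flip_innerₗ] at this
    change (∫ ξ, 𝓕 f ξ • g' ξ) = ∫ ξ, f ξ • 𝓕 g' ξ at this
    rw [hFf] at this
    simpa using this
  have key2 : ∀ ξ, ‖f ξ * 𝓕 g' ξ‖ ≤
      B * D * 2 * (1 + η ^ 2)⁻¹ * ((1 + ξ ^ 2)⁻¹ + (1 + (ξ + η) ^ 2)⁻¹) := by
    intro ξ
    rw [norm_mul, hFg']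
    have h1 := hB (-ξ)
    rw [neg_sq] at h1
    refine (mul_le_mul h1 (hD (ξ + η)) (norm_nonneg _) (by positivity)).trans ?_
    have : B * (1 + ξ ^ 2)⁻¹ * (D * (1 + (ξ + η) ^ 2)⁻¹) =
      B * D * ((1 + ξ ^ 2)⁻¹ * (1 + (ξ + η) ^ 2)⁻¹) := by ring
    rw [this, mul_assoc (B * D), mul_assoc (B * D)]
    refine mul_le_mul_of_nonneg_left ?_ (by positivity)
    rw [← sub_nonneg]
    have e : 2 * (1 + η ^ 2)⁻¹ * ((1 + ξ ^ 2)⁻¹ + (1 + (ξ + η) ^ 2)⁻¹) -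
      (1 + ξ ^ 2)⁻¹ * (1 + (ξ + η) ^ 2)⁻¹ = (3 + (2 * ξ + η) ^ 2) /
        ((1 + η ^ 2) * (1 + ξ ^ 2) * (1 + (ξ + η) ^ 2)) := by
      field_simp; ring
    rw [e]; positivity
  have j1 := integrable_inv_one_add_sq
  have j2 : Integrable (fun ξ : ℝ => (1 + (ξ + η) ^ 2)⁻¹) := j1.comp_add_right η
  rw [key]
  refine (norm_integral_le_of_norm_le ((j1.add j2).const_mul _)
    (Filter.Eventually.of_forall key2)).trans (le_of_eq ?_)
  rw [integral_const_mul, integral_add' j1 j2,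
    integral_add_right_eq_self (fun ξ : ℝ => (1 + ξ ^ 2)⁻¹) η, integral_univ_inv_one_add_sq]
  ring

lemma window_bound {b δ : ℝ} (hb : 0 < b) (hδ : 0 < δ) (A : ℝ) :
    Continuous (fun x => kbBlend b δ x * kbBlend b δ (A - x)) ∧
    (∀ x, x ∉ Set.Ioo 0 A → kbBlend b δ x * kbBlend b δ (A - x) = 0) ∧
    Integrable (fun x => kbBlend b δ x * kbBlend b δ (A - x)) ∧
    ∃ B : ℝ, 0 ≤ B ∧ ∀ h, 0 < h →
      (∫ x, |kbBlend b δ (x + h) * kbBlend b δ (A - (x + h)) -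
        2 * (kbBlend b δ x * kbBlend b δ (A - x)) +
        kbBlend b δ (x - h) * kbBlend b δ (A - (x - h))|) ≤ B * h ^ 2 := by
  obtain ⟨c, hc, hm, hcont, hz, hnn, hle, hlip, hD⟩ := kb_props hb hδ
  set p := kbBlend b δ
  have hwc : Continuous (fun x => p x * p (A - x)) := by fun_prop
  have hsupp : ∀ x, x ∉ Set.Ioo 0 A → p x * p (A - x) = 0 := by
    intro x hx
    rcases le_or_gt x 0 with h | h
    · rw [hz x h, zero_mul]
    · have : A ≤ x := by
        by_contra h'; exact hx ⟨h, not_le.1 h'⟩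
      rw [hz (A - x) (by linarith), mul_zero]
  have hwi : Integrable (fun x => p x * p (A - x)) := by
    refine hwc.integrable_of_hasCompactSupport ?_
    refine HasCompactSupport.intro (isCompact_Icc (a := 0) (b := A)) fun x hx => ?_
    exact hsupp x fun h => hx (Set.Ioo_subset_Icc_self h)
  refine ⟨hwc, hsupp, hwi, 6 * c ^ 2 * δ, by positivity, fun h hh => ?_⟩
  obtain ⟨iD, lD⟩ := hD h hh
  obtain ⟨iM, lM⟩ := mono_diff hm hnn hle hh
  have iM' : Integrable (fun x => p (x + h) - p x) := by simpa using iM.comp_add_right h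
  have lM' : (∫ x, (p (x + h) - p x)) ≤ h * (c * δ) := by
    rw [← integral_sub_right_eq_self _ h]; simpa using lM
  have iR : Integrable (fun x => |p (A - x + h) - 2 * p (A - x) + p (A - x - h)|) :=
    iD.comp_sub_left A
  have lR : (∫ x, |p (A - x + h) - 2 * p (A - x) + p (A - x - h)|) ≤ 2 * c * h ^ 2 := by
    rw [integral_sub_left_eq_self (fun x => |p (x + h) - 2 * p x + p (x - h)|) volume A]
    exact lD
  have hcδ : 0 ≤ c * δ := by positivity
  have hpt : ∀ x, |p (x + h) * p (A - (x + h)) - 2 * (p x * p (A - x)) +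
      p (x - h) * p (A - (x - h))| ≤
      (c * δ) * |p (x + h) - 2 * p x + p (x - h)| +
      (c * δ) * |p (A - x + h) - 2 * p (A - x) + p (A - x - h)| +
      (c * h) * (p (x + h) - p x) + (c * h) * (p x - p (x - h)) := by
    intro x
    have r1 : A - (x + h) = A - x - h := by ring
    have r2 : A - (x - h) = A - x + h := by ring
    rw [r1, r2]
    set q := A - x
    have e : p (x + h) * p (q - h) - 2 * (p x * p q) + p (x - h) * p (q + h) =
      p q * (p (x + h) - 2 * p x + p (x - h)) + p x * (p (q + h) - 2 * p q + p (q - h)) +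
      (p (q - h) - p q) * (p (x + h) - p x) + (p (q + h) - p q) * (p (x - h) - p x) := by ring
    rw [e]
    have m1 : p x ≤ p (x + h) := hm (by linarith)
    have m2 : p (x - h) ≤ p x := hm (by linarith)
    have m3 : p q ≤ p (q + h) := hm (by linarith)
    have m4 : p (q - h) ≤ p q := hm (by linarith)
    have l1 := hlip q h hh
    have l2 := hlip (q + h) h hh
    rw [add_sub_cancel_right] at l2
    refine (abs_add_le _ _).trans (add_le_add ((abs_add_le _ _).trans
      (add_le_add ((abs_add_le _ _).trans (add_le_add ?_ ?_)) ?_)) ?_)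
    · rw [abs_mul, abs_of_nonneg (hnn q)]
      exact mul_le_mul_of_nonneg_right (hle q) (abs_nonneg _)
    · rw [abs_mul, abs_of_nonneg (hnn x)]
      exact mul_le_mul_of_nonneg_right (hle x) (abs_nonneg _)
    · rw [abs_mul, abs_of_nonneg (sub_nonneg.2 m1), abs_of_nonpos (by linarith)]
      exact mul_le_mul_of_nonneg_right (by linarith) (by linarith)
    · rw [abs_mul, abs_of_nonneg (sub_nonneg.2 m3), abs_of_nonpos (by linarith)]
      exact mul_le_mul (by linarith) (by linarith) (by linarith) (by positivity)
  have t1 := iD.const_mul (c * δ)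
  have t2 := iR.const_mul (c * δ)
  have t3 := iM'.const_mul (c * h)
  have t4 := iM.const_mul (c * h)
  refine (integral_mono_of_nonneg (Filter.Eventually.of_forall fun x => abs_nonneg _)
    (((t1.add t2).add t3).add t4) (Filter.Eventually.of_forall hpt)).trans ?_
  rw [integral_add' ((t1.add t2).add t3) t4, integral_add' (t1.add t2) t3, integral_add' t1 t2,
    integral_const_mul, integral_const_mul, integral_const_mul, integral_const_mul]
  have ch : 0 ≤ c * h := by positivity
  nlinarith [mul_le_mul_of_nonneg_left lD hcδ, mul_le_mul_of_nonneg_left lR hcδ,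
    mul_le_mul_of_nonneg_left lM ch, mul_le_mul_of_nonneg_left lM' ch]

open scoped FourierTransform in
lemma sigma_decay {ε K₀ P : ℝ} (hε0 : 0 < ε) (hK₀ : 0 < K₀) (hP : 0 < P) {σ : ℝ → ℂ}
    (h1 : (∫ t : ℝ, ‖σ t‖) ≤ P)
    (h2 : ∀ ω : ℝ, |ω| > K₀ → ‖∫ t : ℝ, σ t * Complex.exp (Complex.I * ω * t)‖ ≤ ε / ω ^ 2)
    (ξ : ℝ) : ‖𝓕 σ ξ‖ ≤ (P * (1 + K₀ ^ 2) + ε * (1 + 1 / K₀ ^ 2)) * (1 + ξ ^ 2)⁻¹ := by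
  have b1 : ‖𝓕 σ ξ‖ ≤ P :=
    (VectorFourier.norm_fourierIntegral_le_integral_norm _ _ _ _ _).trans h1
  have hpi : (1:ℝ) ≤ (2 * π) ^ 2 := by nlinarith [Real.pi_gt_three]
  rw [← div_eq_mul_inv, le_div_iff₀ (by positivity)]
  have hω : (-2 * π * ξ) ^ 2 = (2 * π) ^ 2 * ξ ^ 2 := by ring
  have hξω : ξ ^ 2 ≤ (-2 * π * ξ) ^ 2 := by rw [hω]; nlinarith [sq_nonneg ξ]
  rcases le_or_gt |-2 * π * ξ| K₀ with h | h
  · have : (-2 * π * ξ) ^ 2 ≤ K₀ ^ 2 := by rw [← sq_abs]; gcongr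
    have : ‖𝓕 σ ξ‖ * (1 + ξ ^ 2) ≤ P * (1 + K₀ ^ 2) :=
      mul_le_mul b1 (by linarith) (by positivity) hP.le
    have : 0 ≤ ε * (1 + 1 / K₀ ^ 2) := by positivity
    linarith
  · have e : 𝓕 σ ξ = ∫ t : ℝ, σ t * Complex.exp (Complex.I * ((-2 * π * ξ : ℝ) : ℂ) * t) := by
      rw [Real.fourier_real_eq_integral_exp_smul]
      refine integral_congr_ae (Filter.Eventually.of_forall fun v => ?_)
      simp only [smul_eq_mul]
      rw [mul_comm]
      congr 2
      push_cast; ring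
    have b2 := h2 _ h
    rw [← e] at b2
    have hlt : K₀ ^ 2 < (-2 * π * ξ) ^ 2 := by
      rw [← sq_abs (-2 * π * ξ)]; gcongr
    set ω := -2 * π * ξ
    have hω0 : 0 < ω ^ 2 := lt_trans (by positivity) hlt
    have : ‖𝓕 σ ξ‖ * (1 + ξ ^ 2) ≤ ε / ω ^ 2 * (1 + ω ^ 2) := by gcongr
    have e2 : ε / ω ^ 2 * (1 + ω ^ 2) = ε * (1 + 1 / ω ^ 2) := by
      rw [one_div, mul_add, div_mul_cancel₀ _ hω0.ne', div_eq_mul_inv]; ring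
    have : ε * (1 + 1 / ω ^ 2) ≤ ε * (1 + 1 / K₀ ^ 2) := by gcongr
    have : 0 ≤ P * (1 + K₀ ^ 2) := by positivity
    linarith

lemma single_bound {δ ε K₀ P : ℝ} (hδ : 0 < δ) (hε0 : 0 < ε) (hε1 : ε < 1)
    (hK₀ : 0 < K₀) (hP : 0 < P) (A : ℝ) : ∃ Q : ℝ, 0 ≤ Q ∧ ∀ σ : ℝ → ℂ, Integrable σ →
      (∫ t : ℝ, ‖σ t‖) ≤ P →
      (∀ ω : ℝ, |ω| > K₀ → ‖∫ t : ℝ, σ t * Complex.exp (Complex.I * ω * t)‖ ≤ ε / ω ^ 2) →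
      ∀ κ t : ℝ, 0 < κ →
        Integrable (fun τ => ((Real.sin (κ * (t - τ)) / κ : ℝ) : ℂ) * σ τ *
          ((kbBlend (Real.log (1 / ε)) δ (t - τ) * kbBlend (Real.log (1 / ε)) δ
            (A - (t - τ)) : ℝ) : ℂ)) ∧
        ‖∫ τ, ((Real.sin (κ * (t - τ)) / κ : ℝ) : ℂ) * σ τ *
          ((kbBlend (Real.log (1 / ε)) δ (t - τ) * kbBlend (Real.log (1 / ε)) δ
            (A - (t - τ)) : ℝ) : ℂ)‖ ≤ Q / κ ^ 3 := by
  have hb : 0 < Real.log (1 / ε) := Real.log_pos (by rw [lt_div_iff₀ hε0]; linarith)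
  obtain ⟨hwc, hsupp, hwi, B, hB0, hB⟩ := window_bound hb hδ A
  set w : ℝ → ℝ := fun x => kbBlend (Real.log (1 / ε)) δ x * kbBlend (Real.log (1 / ε)) δ (A - x)
    with hw
  set N := ∫ x, |w x| with hN
  have hN0 : 0 ≤ N := integral_nonneg fun x => abs_nonneg _
  set D := P * (1 + K₀ ^ 2) + ε * (1 + 1 / K₀ ^ 2) with hD
  have hD0 : 0 ≤ D := by positivity
  refine ⟨16 * π ^ 3 * (N + B) * D, by positivity, fun σ hσ hσP hσω κ t hκ => ?_⟩
  set W : ℝ → ℂ := fun τ => ((w (t - τ) : ℝ) : ℂ) with hW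
  have hWc : Continuous W := Complex.continuous_ofReal.comp (hwc.comp (by fun_prop))
  have hWi : Integrable W := (hwi.comp_sub_left t).ofReal
  obtain ⟨c, hc, -, -, -, hp0, hple, -, -⟩ := kb_props hb hδ
  have hWb : ∀ τ, ‖W τ‖ ≤ (c * δ) * (c * δ) := by
    intro τ
    simp only [hW, hw]
    rw [Complex.norm_real, Real.norm_of_nonneg (mul_nonneg (hp0 _) (hp0 _))]
    exact mul_le_mul (hple _) (hple _) (hp0 _) (by positivity)
  have hdec := fourier_decay hWi (N := N) hB0 (by
      simp only [hW, Complex.norm_real, Real.norm_eq_abs]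
      rw [integral_sub_left_eq_self (fun x => |w x|) volume t]) (by
      intro h hh
      refine le_trans (le_of_eq ?_) (hB h hh)
      rw [← integral_sub_left_eq_self (fun x => |kbBlend (Real.log (1 / ε)) δ (x + h) * kbBlend (Real.log (1 / ε)) δ (A - (x + h)) -
        2 * (kbBlend (Real.log (1 / ε)) δ x * kbBlend (Real.log (1 / ε)) δ (A - x)) +
        kbBlend (Real.log (1 / ε)) δ (x - h) * kbBlend (Real.log (1 / ε)) δ (A - (x - h))|) volume t]
      refine integral_congr_ae (Filter.Eventually.of_forall fun x => ?_)
      have e : W (x + h) - 2 * W x + W (x - h) =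
          ((w (t - x + h) - 2 * w (t - x) + w (t - x - h) : ℝ) : ℂ) := by
        simp only [hW]
        rw [show t - (x + h) = t - x - h by ring, show t - (x - h) = t - x + h by ring]
        push_cast; ring
      simp only [e, Complex.norm_real, Real.norm_eq_abs, hw])
  have hconv := conv_bound hWi hWc hσ hdec (sigma_decay hε0 hK₀ hP hσP hσω)
  have hI : ∀ η : ℝ, Integrable
      (fun v => W v * (Complex.exp (↑(-2 * π * v * η) * Complex.I) * σ v)) := fun η =>
    (hσ.bdd_mul (c := 1) (by fun_prop) (Filter.Eventually.of_forall fun v =>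
      (Complex.norm_exp_ofReal_mul_I _).le)).bdd_mul hWc.aestronglyMeasurable
      (Filter.Eventually.of_forall hWb)
  set η := κ / (2 * π) with hη
  have hid : ∀ τ, ((Real.sin (κ * (t - τ)) / κ : ℝ) : ℂ) * σ τ * W τ =
      (Complex.I / (2 * κ) * Complex.exp ((-(κ * t) : ℝ) * Complex.I)) *
        (W τ * (Complex.exp (↑(-2 * π * τ * (-η)) * Complex.I) * σ τ)) -
      (Complex.I / (2 * κ) * Complex.exp (((κ * t) : ℝ) * Complex.I)) *
        (W τ * (Complex.exp (↑(-2 * π * τ * η) * Complex.I) * σ τ)) := by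
    intro τ
    have h1 : -2 * π * τ * (-η) = κ * τ := by rw [hη]; field_simp
    have h2 : -2 * π * τ * η = -(κ * τ) := by rw [hη]; field_simp
    rw [h1, h2, Complex.ofReal_div, Complex.ofReal_sin, Complex.sin]
    have e1 : Complex.exp (-((κ * (t - τ) : ℝ) : ℂ) * Complex.I) =
      Complex.exp ((-(κ * t) : ℝ) * Complex.I) * Complex.exp ((κ * τ : ℝ) * Complex.I) := by
      rw [← Complex.exp_add]; congr 1; push_cast; ring
    have e2 : Complex.exp (((κ * (t - τ) : ℝ) : ℂ) * Complex.I) =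
      Complex.exp ((κ * t : ℝ) * Complex.I) * Complex.exp ((-(κ * τ) : ℝ) * Complex.I) := by
      rw [← Complex.exp_add]; congr 1; push_cast; ring
    rw [e1, e2]
    have : (κ : ℂ) ≠ 0 := by exact_mod_cast hκ.ne'
    field_simp
  have q1 := (hI (-η)).const_mul
    (Complex.I / (2 * κ) * Complex.exp ((-(κ * t) : ℝ) * Complex.I))
  have q2 := (hI η).const_mul
    (Complex.I / (2 * κ) * Complex.exp (((κ * t) : ℝ) * Complex.I))
  change Integrable (fun τ => ((Real.sin (κ * (t - τ)) / κ : ℝ) : ℂ) * σ τ * W τ) ∧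
    ‖∫ τ, ((Real.sin (κ * (t - τ)) / κ : ℝ) : ℂ) * σ τ * W τ‖ ≤ _
  simp_rw [hid]
  refine ⟨q1.sub q2, ?_⟩
  rw [integral_sub q1 q2, integral_const_mul, integral_const_mul]
  have hn : ∀ s : ℝ, ‖Complex.I / (2 * κ) * Complex.exp ((s : ℝ) * Complex.I)‖ = 1 / (2 * κ) := by
    intro s
    rw [norm_mul, Complex.norm_exp_ofReal_mul_I, norm_div, Complex.norm_I, norm_mul,
      Complex.norm_real, Real.norm_of_nonneg hκ.le]
    simp
  refine (norm_sub_le _ _).trans ?_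
  rw [norm_mul (_ * _), norm_mul (_ * _) (∫ a, W a * (Complex.exp (↑(-2 * π * a * η) * Complex.I) * σ a)), hn, hn]
  have c1 := hconv (-η)
  have c2 := hconv η
  rw [neg_sq] at c1
  have hinv : (1 + η ^ 2)⁻¹ ≤ 4 * π ^ 2 / κ ^ 2 := by
    have : 4 * π ^ 2 / κ ^ 2 = (η ^ 2)⁻¹ := by rw [hη]; field_simp; norm_num
    rw [this]
    have : 0 < η := by positivity
    gcongr; linarith
  have c3 : 4 * π * (N + B) * D * (1 + η ^ 2)⁻¹ ≤ 4 * π * (N + B) * D * (4 * π ^ 2 / κ ^ 2) :=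
    mul_le_mul_of_nonneg_left hinv (by positivity)
  have c1' := mul_le_mul_of_nonneg_left (c1.trans c3) (show 0 ≤ 1 / (2 * κ) by positivity)
  have c2' := mul_le_mul_of_nonneg_left (c2.trans c3) (show 0 ≤ 1 / (2 * κ) by positivity)
  refine (add_le_add c1' c2').trans (le_of_eq ?_)
  field_simp
  ring

/-- Decay of the truncated-kernel windowed Fourier coefficients (the paper's
Theorem 2): with `b = ln(1/ε)`, `A = 2√3 + δ`, and `K = K₀ + 2b/(δ√(1 − 1/θ²))`,
there is `C > 0` depending only on `δ, ε, K₀, P, θ` such that for all `M` point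
sources with signatures `σⱼ ∈ L¹ ∩ L²` vanishing for `t ≤ 0`, `‖σⱼ‖₁ ≤ P`, and
ε-bandlimit `K₀`, the coefficients `α(k,t)` obey `|α(k,t)| ≤ C M ε / ‖k‖³` for
all `t ≥ 0` and `‖k‖ > K`. -/
theorem stmt3 (δ ε K₀ P θ : ℝ) (hδ : 0 < δ) (hε0 : 0 < ε) (hε1 : ε < 1)
    (hK₀ : 0 < K₀) (hP : 0 < P) (hθ : 1 < θ) :
    ∃ C : ℝ, 0 < C ∧
      ∀ (M : ℕ) (y : Fin M → EuclideanSpace ℝ (Fin 3)) (σ : Fin M → ℝ → ℂ),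
        (∀ j, Integrable (σ j)) →
        (∀ j, MemLp (σ j) 2 volume) →
        (∀ j, ∀ t : ℝ, t ≤ 0 → σ j t = 0) →
        (∀ j, (∫ t : ℝ, norm (σ j t)) ≤ P) →
        (∀ j, ∀ ω : ℝ, |ω| > K₀ →
          norm (∫ t : ℝ, σ j t * Complex.exp (Complex.I * ω * t)) ≤ ε / ω ^ 2) →
        ∀ (k : EuclideanSpace ℝ (Fin 3)) (t : ℝ), 0 ≤ t →
          ‖k‖ > K₀ + 2 * Real.log (1 / ε) /
              (δ * Real.sqrt (1 - 1 / θ ^ 2)) →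
          norm (∫ τ in (t - (2 * Real.sqrt 3 + δ))..t,
              ((Real.sin (‖k‖ * (t - τ)) / ‖k‖ : ℝ) : ℂ) *
                (∑ j, σ j τ * Complex.exp (Complex.I * ((inner ℝ k (y j) : ℝ) : ℂ))) *
                ((kbBlend (Real.log (1 / ε)) δ (t - τ) : ℝ) : ℂ) *
                ((kbBlend (Real.log (1 / ε)) δ
                    ((2 * Real.sqrt 3 + δ) - t + τ) : ℝ) : ℂ)) ≤
            C * M * ε / ‖k‖ ^ 3 := by
  obtain ⟨Q, hQ0, hQ⟩ := single_bound hδ hε0 hε1 hK₀ hP (2 * Real.sqrt 3 + δ)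
  have hb : 0 < Real.log (1 / ε) := Real.log_pos (by rw [lt_div_iff₀ hε0]; linarith)
  obtain ⟨-, hsupp, -, -⟩ := window_bound hb hδ (2 * Real.sqrt 3 + δ)
  refine ⟨Q / ε + 1, by positivity, fun M y σ hσ _ _ hσP hσω k t _ hk => ?_⟩
  have hκ : 0 < ‖k‖ := by
    have : 0 ≤ 2 * Real.log (1 / ε) / (δ * Real.sqrt (1 - 1 / θ ^ 2)) := by positivity
    linarith
  set A := 2 * Real.sqrt 3 + δ with hA
  set b := Real.log (1 / ε) with hbdef
  set κ := ‖k‖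
  have heq : ∀ τ, ((Real.sin (κ * (t - τ)) / κ : ℝ) : ℂ) *
      (∑ j, σ j τ * Complex.exp (Complex.I * ((inner ℝ k (y j) : ℝ) : ℂ))) *
        ((kbBlend b δ (t - τ) : ℝ) : ℂ) * ((kbBlend b δ (A - t + τ) : ℝ) : ℂ) =
      ∑ j, Complex.exp (Complex.I * ((inner ℝ k (y j) : ℝ) : ℂ)) *
        (((Real.sin (κ * (t - τ)) / κ : ℝ) : ℂ) * σ j τ *
          ((kbBlend b δ (t - τ) * kbBlend b δ (A - (t - τ)) : ℝ) : ℂ)) := by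
    intro τ
    rw [show A - t + τ = A - (t - τ) by ring, Finset.mul_sum, Finset.sum_mul, Finset.sum_mul]
    refine Finset.sum_congr rfl fun j _ => ?_
    push_cast; ring
  simp_rw [heq]
  rw [intervalIntegral.integral_eq_integral_of_support_subset, integral_finsetSum]
  · refine (norm_sum_le _ _).trans ?_
    have : ∀ j ∈ Finset.univ, ‖∫ τ, Complex.exp (Complex.I * ((inner ℝ k (y j) : ℝ) : ℂ)) *
        (((Real.sin (κ * (t - τ)) / κ : ℝ) : ℂ) * σ j τ *
          ((kbBlend b δ (t - τ) * kbBlend b δ (A - (t - τ)) : ℝ) : ℂ))‖ ≤ Q / κ ^ 3 := by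
      intro j _
      rw [integral_const_mul, norm_mul, mul_comm Complex.I, Complex.norm_exp_ofReal_mul_I, one_mul]
      exact (hQ (σ j) (hσ j) (hσP j) (hσω j) κ t hκ).2
    refine (Finset.sum_le_sum this).trans ?_
    rw [Finset.sum_const, Finset.card_univ, Fintype.card_fin, nsmul_eq_mul, ← mul_div_assoc]
    refine div_le_div_of_nonneg_right ?_ (by positivity)
    have : (Q / ε + 1) * M * ε = M * Q + M * ε := by field_simp
    rw [this]
    have : 0 ≤ (M : ℝ) * ε := by positivity
    linarith
  · intro j _
    exact ((hQ (σ j) (hσ j) (hσP j) (hσω j) κ t hκ).1).const_mul _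
  · intro τ hτ
    by_contra hn
    apply hτ
    have : t - τ ∉ Set.Ioo 0 A := by
      intro h
      exact hn ⟨by linarith [h.2], by linarith [h.1]⟩
    have h0 := hsupp _ this
    refine Finset.sum_eq_zero fun j _ => ?_
    rw [h0]; simp
end

section
/- Let f, g ∈ L¹(ℝ) ∩ L²(ℝ) be complex-valued, let h(t) = f(t)g(t), and let 0 < ε < 1. Denote Fourier transforms by f̂(ω) = ∫_ℝ f(t) e^{iωt} dt. Suppose there exist constants C₁, C₂ > 0 and K₁, K₂ > 0 such that |f̂(ω)| ≤ C₁ε/ω² for all |ω| ≥ K₁ and |ĝ(ω)| ≤ C₂ε/ω² for all |ω| ≥ K₂. Then for all real ω with |ω| ≥ K₁ + K₂, |ĥ(ω)| ≤ C̃ · ε/ω², where C̃ = (1/(2π)) [ C₂ ‖f̂‖_{L¹} (1 + K₁/K₂)² + C₁ ‖ĝ‖_{L¹} (1 + K₂/K₁)² + 8 C₁ C₂ (1/K₁ + 1/K₂) ]. -/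
open Real MeasureTheory
open scoped FourierTransform

lemma aux_flip (u v : ℝ → ℂ) (hu : Integrable u) (hv : Integrable v) :
    ∫ x, 𝓕 u x * v x = ∫ x, u x * 𝓕 v x := by
  simpa using! (VectorFourier.integral_fourierIntegral_smul_eq_flip (L := innerₗ ℝ)
    Real.continuous_fourierChar (innerSL ℝ).continuous₂ hu hv)

lemma aux_cont (u : ℝ → ℂ) (hu : Integrable u) : Continuous (𝓕 u) :=
  VectorFourier.fourierIntegral_continuous Real.continuous_fourierChar
    (innerSL ℝ).continuous₂ hu

open scoped ContDiff in
lemma aux_inv (u : ℝ → ℂ) (hu : Integrable u) (hF : Integrable (𝓕 u)) :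
    ∀ᵐ x, u x = 𝓕 (fun y => 𝓕 u (-y)) x := by
  have hF' : Integrable (fun y => 𝓕 u (-y)) := hF.comp_neg
  refine ae_eq_of_integral_contDiff_smul_eq hu.locallyIntegrable
    (aux_cont _ hF').locallyIntegrable ?_
  intro φ hφ hs
  have hs' : HasCompactSupport (fun x => (φ x : ℂ)) :=
    hs.comp_left (g := fun r : ℝ => (r : ℂ)) (by simp)
  have hφ' : ContDiff ℝ ∞ (fun x => (φ x : ℂ)) := Complex.ofRealCLM.contDiff.comp hφ
  let Φ : SchwartzMap ℝ ℂ := hs'.toSchwartzMap hφ'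
  have hΦ : ∀ x, Φ x = (φ x : ℂ) := fun x => rfl
  let Ψ : SchwartzMap ℝ ℂ := 𝓕⁻ Φ
  have hΨ : 𝓕 (Ψ : ℝ → ℂ) = (Φ : ℝ → ℂ) := by
    rw [← SchwartzMap.fourier_coe]
    exact congrArg (fun (Ψ : SchwartzMap ℝ ℂ) => (Ψ : ℝ → ℂ))
      (FourierTransform.fourier_fourierInv_eq (F := SchwartzMap ℝ ℂ) Φ)
  have h1 : ∫ x, φ x • u x = ∫ x, u x * 𝓕 (Ψ : ℝ → ℂ) x := by
    rw [hΨ]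
    congr 1; ext x
    simp [hΦ, mul_comm]
  have h2 : ∫ x, φ x • 𝓕 (fun y => 𝓕 u (-y)) x = ∫ x, 𝓕 (fun y => 𝓕 u (-y)) x * Φ x := by
    congr 1; ext x
    simp [hΦ, mul_comm]
  rw [h1, h2, ← aux_flip u _ hu Ψ.integrable, aux_flip _ _ hF' Φ.integrable,
    ← integral_neg_eq_self]
  congr 1; ext x
  congr 1
  change (𝓕⁻ Φ : SchwartzMap ℝ ℂ) (-x) = _
  rw [SchwartzMap.fourierInv_coe, Real.fourierInv_eq_fourier_neg, neg_neg]

noncomputable def auxq (K w : ℝ) : ℝ := Set.indicator (Set.Ioi K) (fun x => (x ^ 2)⁻¹) |w|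

lemma auxq_nonneg (K w : ℝ) : 0 ≤ auxq K w :=
  Set.indicator_nonneg (fun x _ => by positivity) _

lemma auxq_of_lt {K w : ℝ} (h : K < |w|) : auxq K w = (w ^ 2)⁻¹ := by
  rw [auxq, Set.indicator_of_mem (by exact h), sq_abs]

lemma auxq_integrable {K : ℝ} (hK : 0 < K) : Integrable (auxq K) := by
  refine (integrable_inv_one_add_sq.const_mul (1 + (K ^ 2)⁻¹)).mono' ?_ ?_
  · refine Measurable.aestronglyMeasurable ?_
    refine Measurable.comp (Measurable.indicator (by fun_prop) measurableSet_Ioi) (by fun_prop)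
  · refine Filter.Eventually.of_forall fun w => ?_
    rw [Real.norm_of_nonneg (auxq_nonneg _ _)]
    by_cases h : K < |w|
    · rw [auxq_of_lt h]
      have h0 : 0 < |w| := hK.trans h
      have h2 : K ^ 2 ≤ w ^ 2 := by rw [← sq_abs w]; gcongr
      have h3 : 0 < w ^ 2 := by rw [← sq_abs w]; positivity
      rw [← div_eq_mul_inv, le_div_iff₀ (by positivity), inv_mul_le_iff₀ h3]
      have : 1 ≤ w ^ 2 * (K ^ 2)⁻¹ := by
        rw [← div_eq_mul_inv, le_div_iff₀ (by positivity)]; linarith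
      linarith
    · rw [auxq, Set.indicator_of_notMem (by exact h)]
      positivity

lemma auxq_integral {K : ℝ} (hK : 0 < K) : ∫ w, auxq K w = 2 / K := by
  unfold auxq
  rw [integral_comp_abs (f := Set.indicator (Set.Ioi K) (fun x => (x ^ 2)⁻¹)),
    setIntegral_indicator measurableSet_Ioi, Set.Ioi_inter_Ioi, max_eq_right hK.le]
  have h := integral_Ioi_rpow_of_lt (a := -2) (by norm_num) hK
  have h' : ∫ x in Set.Ioi K, (x ^ 2)⁻¹ = ∫ x in Set.Ioi K, x ^ (-2 : ℝ) := by
    refine setIntegral_congr_fun measurableSet_Ioi fun x hx => ?_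
    have hx0 : 0 < x := hK.trans hx
    rw [Real.rpow_neg hx0.le]
    norm_cast
  rw [h', h]
  norm_num
  rw [Real.rpow_neg_one, div_eq_mul_inv]

lemma aux_hat_eq (u uhat : ℝ → ℂ)
    (h : ∀ ω : ℝ, uhat ω = ∫ t : ℝ, u t * Complex.exp (Complex.I * ω * t)) (v : ℝ) :
    𝓕 u v = uhat (-(2 * π * v)) := by
  rw [h, Real.fourier_real_eq_integral_exp_smul]
  congr 1; ext t
  rw [smul_eq_mul, mul_comm]
  congr 2
  push_cast; ring

lemma aux_hat_int (u uhat : ℝ → ℂ) (hu : Integrable u) {K D : ℝ} (hK : 0 < K)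
    (h : ∀ ω : ℝ, uhat ω = ∫ t : ℝ, u t * Complex.exp (Complex.I * ω * t))
    (hd : ∀ ω : ℝ, |ω| ≥ K → ‖uhat ω‖ ≤ D / ω ^ 2) : Integrable uhat := by
  have hc : Continuous uhat := by
    have : uhat = fun ω => 𝓕 u (-(ω / (2 * π))) := by
      ext ω
      rw [aux_hat_eq u uhat h]
      congr 1
      field_simp
    rw [this]
    exact (aux_cont u hu).comp (by fun_prop)
  have h1 : IntegrableOn uhat (Set.Icc (-K) K) := hc.continuousOn.integrableOn_Icc
  rw [← integrableOn_univ, ← Set.union_compl_self (Set.Icc (-K) K)]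
  refine h1.union ?_
  refine Integrable.mono' ((auxq_integrable hK).const_mul D).integrableOn
    hc.aestronglyMeasurable ?_
  refine (ae_restrict_iff' measurableSet_Icc.compl).2 (Filter.Eventually.of_forall ?_)
  intro w hw
  have hw' : K < |w| := by
    by_contra hh
    exact hw (abs_le.1 (not_lt.1 hh))
  rw [auxq_of_lt hw', ← div_eq_mul_inv]
  exact hd w hw'.le

lemma aux_conv (f g fhat ghat : ℝ → ℂ) (hf1 : Integrable f) (hg1 : Integrable g)
    (hfhat : ∀ ω : ℝ, fhat ω = ∫ t : ℝ, f t * Complex.exp (Complex.I * ω * t))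
    (hghat : ∀ ω : ℝ, ghat ω = ∫ t : ℝ, g t * Complex.exp (Complex.I * ω * t))
    (hfi : Integrable fhat) (ω : ℝ) :
    ∫ t : ℝ, f t * g t * Complex.exp (Complex.I * ω * t) =
      ((1 / (2 * π) : ℝ) : ℂ) * ∫ w, fhat w * ghat (ω - w) := by
  have hF : Integrable (𝓕 f) := by
    have : 𝓕 f = fun v => fhat ((-(2 * π)) * v) := by
      ext v; rw [aux_hat_eq f fhat hfhat]; congr 1; ring
    rw [this]
    exact hfi.comp_mul_left' (by simp [Real.pi_ne_zero])
  have hG : Integrable (fun t => g t * Complex.exp (Complex.I * ω * t)) := by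
    refine hg1.mul_bdd (c := 1) (Continuous.aestronglyMeasurable (by fun_prop)) ?_
    refine Filter.Eventually.of_forall fun t => ?_
    have : Complex.I * ω * t = ((ω * t : ℝ) : ℂ) * Complex.I := by push_cast; ring
    rw [this, Complex.norm_exp_ofReal_mul_I]
  have e1 : ∫ t : ℝ, f t * g t * Complex.exp (Complex.I * ω * t) =
      ∫ t, 𝓕 (fun y => 𝓕 f (-y)) t * (g t * Complex.exp (Complex.I * ω * t)) := by
    refine integral_congr_ae ?_
    filter_upwards [aux_inv f hf1 hF] with t ht
    rw [← ht, mul_assoc]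
  rw [e1, aux_flip _ _ hF.comp_neg hG]
  have e2 : ∀ v, 𝓕 f (-v) * 𝓕 (fun t => g t * Complex.exp (Complex.I * ω * t)) v =
      (fun w => fhat w * ghat (ω - w)) (2 * π * v) := by
    intro v
    simp only
    rw [aux_hat_eq f fhat hfhat, hghat, Real.fourier_real_eq_integral_exp_smul]
    congr 1
    · congr 1; ring
    · congr 1; ext t
      rw [smul_eq_mul, mul_comm, mul_assoc, ← Complex.exp_add]
      congr 2
      push_cast; ring
  rw [integral_congr_ae (Filter.Eventually.of_forall e2), Measure.integral_comp_mul_left (fun w => fhat w * ghat (ω - w)) (2 * π), Complex.real_smul,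
    abs_of_pos (by positivity), one_div]

lemma aux_far {K₁ K₂ x y W D : ℝ} (hK₁ : 0 < K₁) (hK₂ : 0 < K₂) (hD : 0 < D)
    (hW : K₁ + K₂ ≤ W) (hx : |x| ≤ K₁) (hxy : W ≤ |x| + |y|) :
    K₂ ≤ |y| ∧ D / y ^ 2 ≤ D * (1 + K₁ / K₂) ^ 2 / W ^ 2 := by
  have h1 : K₂ ≤ |y| := by linarith
  refine ⟨h1, ?_⟩
  have hy : 0 < |y| := by linarith
  have h2 : W ≤ |y| * (1 + K₁ / K₂) := by
    have : K₁ ≤ |y| * (K₁ / K₂) := by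
      rw [← mul_div_assoc, le_div_iff₀ hK₂]; nlinarith
    nlinarith
  have hW0 : 0 < W := by linarith
  rw [← sq_abs y, div_le_div_iff₀ (by positivity) (by positivity), mul_assoc, ← mul_pow]
  gcongr
  linarith

lemma aux_point {C₁ C₂ K₁ K₂ ε a b x y W : ℝ} (hε0 : 0 < ε) (hε1 : ε < 1)
    (hC₁ : 0 < C₁) (hC₂ : 0 < C₂) (hK₁ : 0 < K₁) (hK₂ : 0 < K₂)
    (ha0 : 0 ≤ a) (hb0 : 0 ≤ b)
    (ha : |x| ≥ K₁ → a ≤ C₁ * ε / x ^ 2) (hb : |y| ≥ K₂ → b ≤ C₂ * ε / y ^ 2)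
    (hW : K₁ + K₂ ≤ W) (hxy : W ≤ |x| + |y|) :
    a * b ≤ (C₂ * (1 + K₁ / K₂) ^ 2 * (ε / W ^ 2)) * a +
      (C₁ * (1 + K₂ / K₁) ^ 2 * (ε / W ^ 2)) * b +
      ((4 * C₁ * C₂ * (ε / W ^ 2)) * auxq K₁ x + (4 * C₁ * C₂ * (ε / W ^ 2)) * auxq K₂ y) := by
  have hW0 : 0 < W := by linarith
  have q1 := auxq_nonneg K₁ x
  have q2 := auxq_nonneg K₂ y
  have p1 : 0 ≤ (C₂ * (1 + K₁ / K₂) ^ 2 * (ε / W ^ 2)) * a := by positivity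
  have p2 : 0 ≤ (C₁ * (1 + K₂ / K₁) ^ 2 * (ε / W ^ 2)) * b := by positivity
  have p3 : 0 ≤ (4 * C₁ * C₂ * (ε / W ^ 2)) * auxq K₁ x := by positivity
  have p4 : 0 ≤ (4 * C₁ * C₂ * (ε / W ^ 2)) * auxq K₂ y := by positivity
  rcases le_or_gt |x| K₁ with hx | hx
  · obtain ⟨h1, h2⟩ := aux_far (D := C₂ * ε) hK₁ hK₂ (by positivity) hW hx hxy
    have h3 := (hb h1).trans h2
    have := mul_le_mul_of_nonneg_left h3 ha0
    have e : a * (C₂ * ε * (1 + K₁ / K₂) ^ 2 / W ^ 2) =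
      (C₂ * (1 + K₁ / K₂) ^ 2 * (ε / W ^ 2)) * a := by ring
    linarith
  rcases le_or_gt |y| K₂ with hy | hy
  · obtain ⟨h1, h2⟩ := aux_far (D := C₁ * ε) hK₂ hK₁ (by positivity)
      (by linarith : K₂ + K₁ ≤ W) hy (by linarith : W ≤ |y| + |x|)
    have h3 := (ha h1).trans h2
    have := mul_le_mul_of_nonneg_right h3 hb0
    have e : (C₁ * ε * (1 + K₂ / K₁) ^ 2 / W ^ 2) * b =
      (C₁ * (1 + K₂ / K₁) ^ 2 * (ε / W ^ 2)) * b := by ring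
    linarith
  have hx0 : 0 < |x| := by linarith
  have hy0 : 0 < |y| := by linarith
  have hab : a * b ≤ (C₁ * ε / x ^ 2) * (C₂ * ε / y ^ 2) :=
    mul_le_mul (ha hx.le) (hb hy.le) hb0 (by positivity)
  have hab2 : a * b ≤ C₁ * C₂ * ε * ((x ^ 2)⁻¹ * (y ^ 2)⁻¹) := by
    refine hab.trans ?_
    have : (C₁ * ε / x ^ 2) * (C₂ * ε / y ^ 2) =
      C₁ * C₂ * ε * ((x ^ 2)⁻¹ * (y ^ 2)⁻¹) * ε := by ring
    rw [this]
    exact mul_le_of_le_one_right (by positivity) hε1.le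
  rw [auxq_of_lt hx, auxq_of_lt hy] at *
  have key : ∀ z : ℝ, W / 2 ≤ |z| → (z ^ 2)⁻¹ ≤ 4 * (1 / W ^ 2) := by
    intro z hz
    have : (W / 2) ^ 2 ≤ z ^ 2 := by rw [← sq_abs z]; gcongr
    have h := inv_anti₀ (by positivity) this
    refine h.trans (le_of_eq ?_)
    field_simp
    try norm_num
  have hc : 0 ≤ C₁ * C₂ * ε := by positivity
  rcases le_or_gt (W / 2) |x| with h | h
  · have k := mul_le_mul_of_nonneg_right (key x h) (by positivity : 0 ≤ (y ^ 2)⁻¹)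
    have := mul_le_mul_of_nonneg_left k hc
    have e : C₁ * C₂ * ε * (4 * (1 / W ^ 2) * (y ^ 2)⁻¹) =
      (4 * C₁ * C₂ * (ε / W ^ 2)) * (y ^ 2)⁻¹ := by ring
    linarith
  · have k := mul_le_mul_of_nonneg_left (key y (by linarith)) (by positivity : 0 ≤ (x ^ 2)⁻¹)
    have := mul_le_mul_of_nonneg_left k hc
    have e : C₁ * C₂ * ε * ((x ^ 2)⁻¹ * (4 * (1 / W ^ 2))) =
      (4 * C₁ * C₂ * (ε / W ^ 2)) * (x ^ 2)⁻¹ := by ring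
    linarith

/-- The paper's Lemma B.1: near-quadratic Fourier decay is preserved under
pointwise multiplication, with the explicit constant and combined bandlimit
`K₁ + K₂`. Fourier transforms use the convention `f̂(ω) = ∫ f(t) e^{iωt} dt`. -/
theorem stmt4 (f g : ℝ → ℂ)
    (hf1 : Integrable f) (hf2 : MemLp f 2 volume)
    (hg1 : Integrable g) (hg2 : MemLp g 2 volume)
    (ε : ℝ) (hε0 : 0 < ε) (hε1 : ε < 1)
    (C₁ C₂ K₁ K₂ : ℝ) (hC₁ : 0 < C₁) (hC₂ : 0 < C₂) (hK₁ : 0 < K₁) (hK₂ : 0 < K₂)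
    (fhat ghat : ℝ → ℂ)
    (hfhat : ∀ ω : ℝ, fhat ω = ∫ t : ℝ, f t * Complex.exp (Complex.I * ω * t))
    (hghat : ∀ ω : ℝ, ghat ω = ∫ t : ℝ, g t * Complex.exp (Complex.I * ω * t))
    (hfdecay : ∀ ω : ℝ, |ω| ≥ K₁ → ‖fhat ω‖ ≤ C₁ * ε / ω ^ 2)
    (hgdecay : ∀ ω : ℝ, |ω| ≥ K₂ → ‖ghat ω‖ ≤ C₂ * ε / ω ^ 2)
    (ω : ℝ) (hω : |ω| ≥ K₁ + K₂) :
    ‖∫ t : ℝ, f t * g t * Complex.exp (Complex.I * ω * t)‖ ≤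
      (1 / (2 * π)) *
        (C₂ * (∫ w : ℝ, ‖fhat w‖) * (1 + K₁ / K₂) ^ 2 +
          C₁ * (∫ w : ℝ, ‖ghat w‖) * (1 + K₂ / K₁) ^ 2 +
          8 * C₁ * C₂ * (1 / K₁ + 1 / K₂)) * ε / ω ^ 2 := by
  have hfi := aux_hat_int f fhat hf1 hK₁ hfhat hfdecay
  have hgi := aux_hat_int g ghat hg1 hK₂ hghat hgdecay
  rw [aux_conv f g fhat ghat hf1 hg1 hfhat hghat hfi ω, norm_mul, Complex.norm_real,
    Real.norm_of_nonneg (by positivity)]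
  have i1 := hfi.norm.const_mul (C₂ * (1 + K₁ / K₂) ^ 2 * (ε / |ω| ^ 2))
  have i2 := (hgi.comp_sub_left ω).norm.const_mul (C₁ * (1 + K₂ / K₁) ^ 2 * (ε / |ω| ^ 2))
  have i3 := (auxq_integrable hK₁).const_mul (4 * C₁ * C₂ * (ε / |ω| ^ 2))
  have i4 := ((auxq_integrable hK₂).comp_sub_left ω).const_mul (4 * C₁ * C₂ * (ε / |ω| ^ 2))
  have hb : ‖∫ w, fhat w * ghat (ω - w)‖ ≤ ∫ w,
      ((C₂ * (1 + K₁ / K₂) ^ 2 * (ε / |ω| ^ 2)) * ‖fhat w‖ +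
      (C₁ * (1 + K₂ / K₁) ^ 2 * (ε / |ω| ^ 2)) * ‖ghat (ω - w)‖ +
      ((4 * C₁ * C₂ * (ε / |ω| ^ 2)) * auxq K₁ w +
        (4 * C₁ * C₂ * (ε / |ω| ^ 2)) * auxq K₂ (ω - w))) := by
    refine norm_integral_le_of_norm_le ((i1.add i2).add (i3.add i4)) ?_
    refine Filter.Eventually.of_forall fun w => ?_
    rw [norm_mul]
    refine aux_point hε0 hε1 hC₁ hC₂ hK₁ hK₂ (norm_nonneg _) (norm_nonneg _)
      (hfdecay w) (hgdecay (ω - w)) hω ?_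
    have := abs_add_le w (ω - w)
    rwa [add_sub_cancel] at this
  have i12 := i1.add i2
  have i34 := i3.add i4
  simp only [Pi.add_def] at i12 i34
  rw [integral_add i12 i34, integral_add i1 i2, integral_add i3 i4,
    integral_const_mul, integral_const_mul, integral_const_mul, integral_const_mul,
    integral_sub_left_eq_self (fun w => ‖ghat w‖) volume ω,
    integral_sub_left_eq_self (auxq K₂) volume ω, auxq_integral hK₁, auxq_integral hK₂,
    sq_abs] at hb
  refine (mul_le_mul_of_nonneg_left hb (by positivity)).trans (le_of_eq ?_)
  ring
end

section
/- Let K₁ > 0, K₂ > 0 and let ω be a nonzero real number. Then ∫_{{ξ ∈ ℝ : |ξ| > K₁ and |ω − ξ| > K₂}} dξ / (ξ² (ω − ξ)²) ≤ (8/ω²) · (1/K₁ + 1/K₂). -/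
open Real MeasureTheory

theorem tail_aux (K : ℝ) (hK : 0 < K) :
    Integrable (fun x : ℝ => (Set.Ioi K).indicator (fun y : ℝ => y ^ (-2 : ℝ)) |x|) ∧
    (∫ x : ℝ, (Set.Ioi K).indicator (fun y : ℝ => y ^ (-2 : ℝ)) |x|) = 2 / K := by
  have hi : IntegrableOn (fun y : ℝ => y ^ (-2 : ℝ)) (Set.Ioi K) :=
    integrableOn_Ioi_rpow_of_lt (by norm_num) hK
  constructor
  · have h1 : Integrable ((Set.Ioi K).indicator (fun y : ℝ => y ^ (-2 : ℝ))) :=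
      hi.integrable_indicator measurableSet_Ioi
    refine (h1.add h1.comp_neg).congr (Filter.Eventually.of_forall fun x => ?_)
    simp only [Pi.add_apply, Set.indicator_apply, Set.mem_Ioi]
    rcases le_total 0 x with h | h
    · rw [abs_of_nonneg h, if_neg (show ¬ K < -x by linarith), add_zero]
    · rw [abs_of_nonpos h, if_neg (show ¬ K < x by linarith), zero_add]
  · rw [integral_comp_abs (f := (Set.Ioi K).indicator (fun y : ℝ => y ^ (-2 : ℝ))),
      setIntegral_indicator measurableSet_Ioi,
      Set.inter_eq_right.mpr (Set.Ioi_subset_Ioi hK.le),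
      integral_Ioi_rpow_of_lt (by norm_num) hK]
    norm_num [Real.rpow_neg_one]
    ring

/-- The tail–tail convolution integral bound (the piece `H₂`) in the proof of
the paper's Lemma B.1:
`∫_{|ξ|>K₁, |ω−ξ|>K₂} dξ/(ξ²(ω−ξ)²) ≤ (8/ω²)(1/K₁ + 1/K₂)`. -/
theorem stmt6 (K₁ K₂ : ℝ) (hK₁ : 0 < K₁) (hK₂ : 0 < K₂) (ω : ℝ) (hω : ω ≠ 0) :
    (∫ ξ in {ξ : ℝ | K₁ < |ξ| ∧ K₂ < |ω - ξ|}, 1 / (ξ ^ 2 * (ω - ξ) ^ 2)) ≤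
      8 / ω ^ 2 * (1 / K₁ + 1 / K₂) := by
  obtain ⟨i1, e1⟩ := tail_aux K₁ hK₁
  obtain ⟨i2, e2⟩ := tail_aux K₂ hK₂
  have i2' := i2.comp_sub_left ω
  have e2' := integral_sub_left_eq_self
    (fun x : ℝ => (Set.Ioi K₂).indicator (fun y : ℝ => y ^ (-2 : ℝ)) |x|) volume ω
  rw [e2] at e2'
  have hS : MeasurableSet {ξ : ℝ | K₁ < |ξ| ∧ K₂ < |ω - ξ|} := by
    have c1 : IsOpen {ξ : ℝ | K₁ < |ξ|} := isOpen_lt (by fun_prop) (by fun_prop)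
    have c2 : IsOpen {ξ : ℝ | K₂ < |ω - ξ|} := isOpen_lt (by fun_prop) (by fun_prop)
    exact (c1.inter c2).measurableSet
  have key : ∀ x : ℝ, 0 < |x| → |x| ^ (-2 : ℝ) = 1 / x ^ 2 := by
    intro x hx
    rw [Real.rpow_neg hx.le]
    norm_num
  have hn : ∀ (K x : ℝ), 0 ≤ (Set.Ioi K).indicator (fun y : ℝ => y ^ (-2 : ℝ)) |x| := by
    intro K x
    rw [Set.indicator_apply]
    split_ifs <;> positivity
  rw [← integral_indicator hS]
  calc _ ≤ ∫ ξ : ℝ, 4 / ω ^ 2 * ((Set.Ioi K₁).indicator (fun y : ℝ => y ^ (-2 : ℝ)) |ξ| +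
        (Set.Ioi K₂).indicator (fun y : ℝ => y ^ (-2 : ℝ)) |ω - ξ|) := by
        apply integral_mono_of_nonneg
        · refine Filter.Eventually.of_forall fun x => Set.indicator_nonneg (fun y _ => ?_) x
          positivity
        · exact (i1.add i2').const_mul _
        · refine Filter.Eventually.of_forall fun x => ?_
          by_cases hx : x ∈ {ξ : ℝ | K₁ < |ξ| ∧ K₂ < |ω - ξ|}
          · have hx1 := hx.1
            have hx2 := hx.2
            have p1 : 0 < |x| := hK₁.trans hx1
            have p2 : 0 < |ω - x| := hK₂.trans hx2
            simp only [Set.indicator_of_mem hx]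
            rw [Set.indicator_of_mem (show |x| ∈ Set.Ioi K₁ from hx1),
              Set.indicator_of_mem (show |ω - x| ∈ Set.Ioi K₂ from hx2), key _ p1, key _ p2]
            have q1 : x ≠ 0 := abs_pos.mp p1
            have q2 : ω - x ≠ 0 := abs_pos.mp p2
            have : 4 / ω ^ 2 * (1 / x ^ 2 + 1 / (ω - x) ^ 2)
                = (4 * (x ^ 2 + (ω - x) ^ 2) / ω ^ 2) * (1 / (x ^ 2 * (ω - x) ^ 2)) := by
              field_simp
              ring
            rw [this]
            apply le_mul_of_one_le_left (by positivity)
            rw [le_div_iff₀ (by positivity)]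
            nlinarith [sq_nonneg (2 * x - ω), sq_nonneg ω]
          · simp only [Set.indicator_of_notMem hx]
            have := hn K₁ x
            have := hn K₂ (ω - x)
            positivity
    _ = _ := by
        rw [integral_const_mul, integral_add i1 i2', e1, e2']
        ring
end

section
/- Let κ > 0, A > 0, let w : ℝ → ℝ be twice continuously differentiable with w(t) = 0 for all t ≤ 0 and for all t ≥ A, and let s : ℝ → ℂ be continuous. Define α(t) = ∫_ℝ (sin(κ(t − τ))/κ) s(τ) w(t − τ) dτ. Then α is twice continuously differentiable and satisfies, for all t ∈ ℝ, α''(t) + κ² α(t) = ∫_ℝ [ 2 cos(κ(t − τ)) w'(t − τ) + (sin(κ(t − τ))/κ) w''(t − τ) ] s(τ) dτ. -/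
open Real MeasureTheory

/-- The windowed sine-kernel convolution satisfies the harmonic-oscillator ODE
whose forcing involves only the region where the window varies (derivation of
the ODE (4.1) with forcing (4.2) in the paper): for a `C²` window `w` vanishing
outside `(0, A)` and a continuous signal `s`,
`α(t) = ∫ (sin(κ(t−τ))/κ) s(τ) w(t−τ) dτ` is `C²` and
`α'' + κ²α = ∫ [2cos(κ(t−τ)) w'(t−τ) + (sin(κ(t−τ))/κ) w''(t−τ)] s(τ) dτ`. -/
theorem stmt14 (κ A : ℝ) (hκ : 0 < κ) (hA : 0 < A)
    (w : ℝ → ℝ) (hw : ContDiff ℝ 2 w)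
    (hw0 : ∀ t : ℝ, t ≤ 0 → w t = 0) (hwA : ∀ t : ℝ, A ≤ t → w t = 0)
    (s : ℝ → ℂ) (hs : Continuous s)
    (α : ℝ → ℂ)
    (hα : ∀ t : ℝ, α t = ∫ τ : ℝ,
      ((Real.sin (κ * (t - τ)) / κ : ℝ) : ℂ) * s τ * ((w (t - τ) : ℝ) : ℂ)) :
    ContDiff ℝ 2 α ∧
      ∀ t : ℝ, deriv (deriv α) t + (κ : ℂ) ^ 2 * α t =
        ∫ τ : ℝ, ((2 * Real.cos (κ * (t - τ)) * deriv w (t - τ) +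
            Real.sin (κ * (t - τ)) / κ * deriv (deriv w) (t - τ) : ℝ) : ℂ) * s τ := by
  set g : ℝ → ℝ := fun u => Real.sin (κ * u) / κ * w u with hg
  let L : ℂ →L[ℝ] ℝ →L[ℝ] ℂ := (ContinuousLinearMap.lsmul ℝ ℝ : ℝ →L[ℝ] ℂ →L[ℝ] ℂ).flip
  have hL : ∀ z r, L z r = (r : ℂ) * z := fun z r => by
    simp [L]
  have hgc : ContDiff ℝ 2 g := by
    have h1 : ContDiff ℝ 2 (fun u : ℝ => Real.sin (κ * u) / κ) := by fun_prop
    exact h1.mul hw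
  have hgs : HasCompactSupport g := by
    refine HasCompactSupport.intro (isCompact_Icc (a := 0) (b := A)) fun x hx => ?_
    have hwx : w x = 0 := by
      by_cases h : x ≤ 0
      · exact hw0 x h
      · refine hwA x ?_
        by_contra h'
        exact hx ⟨by linarith, by linarith⟩
    simp [hg, hwx]
  have hsl : LocallyIntegrable s volume := hs.locallyIntegrable
  have hαc : α = convolution s g L volume := by
    funext t
    rw [hα t]
    simp only [convolution, hL, hg]
    congr 1
    funext τ
    push_cast
    ring
  have hw' : ContDiff ℝ 1 (deriv w) := hw.deriv'
  have hg' : ContDiff ℝ 1 (deriv g) := hgc.deriv'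
  have hd1 : deriv α = convolution s (deriv g) L volume := by
    funext t
    rw [hαc]
    exact (HasCompactSupport.hasDerivAt_convolution_right L hsl hgs
      (hgc.of_le (by norm_num)) t).deriv
  have hd2 : deriv (deriv α) = convolution s (deriv (deriv g)) L volume := by
    funext t
    rw [hd1]
    exact (HasCompactSupport.hasDerivAt_convolution_right L hsl hgs.deriv hg' t).deriv
  have hsin : ∀ u : ℝ, HasDerivAt (fun u : ℝ => Real.sin (κ * u) / κ) (Real.cos (κ * u)) u := by
    intro u
    have := (((hasDerivAt_id' u).const_mul κ).sin).div_const κ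
    rw [mul_one, mul_div_assoc, div_self hκ.ne', mul_one] at this
    exact this
  have hcos : ∀ u : ℝ, HasDerivAt (fun u : ℝ => Real.cos (κ * u)) (-κ * Real.sin (κ * u)) u := by
    intro u
    have := (((hasDerivAt_id' u).const_mul κ).cos)
    convert this using 1
    ring
  have hwd : ∀ u, HasDerivAt w (deriv w u) u := fun u =>
    (hw.differentiable (by norm_num) u).hasDerivAt
  have hwd' : ∀ u, HasDerivAt (deriv w) (deriv (deriv w) u) u := fun u =>
    (hw'.differentiable (by norm_num) u).hasDerivAt
  have hg1 : deriv g = fun u => Real.cos (κ * u) * w u + Real.sin (κ * u) / κ * deriv w u := by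
    funext u
    exact ((hsin u).mul (hwd u)).deriv
  have hg2 : ∀ u, deriv (deriv g) u = -κ * Real.sin (κ * u) * w u + Real.cos (κ * u) * deriv w u
      + (Real.cos (κ * u) * deriv w u + Real.sin (κ * u) / κ * deriv (deriv w) u) := by
    intro u
    rw [hg1]
    exact (((hcos u).mul (hwd u)).add ((hsin u).mul (hwd' u))).deriv
  refine ⟨?_, fun t => ?_⟩
  · rw [hαc]
    exact HasCompactSupport.contDiff_convolution_right (n := 2) L hgs hsl hgc
  · have e1 : Integrable (fun τ => L (s τ) (g (t - τ))) volume :=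
      HasCompactSupport.convolutionExists_right L hgs hsl hgc.continuous t
    have e2 : Integrable (fun τ => L (s τ) (deriv (deriv g) (t - τ))) volume :=
      HasCompactSupport.convolutionExists_right L hgs.deriv.deriv hsl
        (hg'.continuous_deriv le_rfl) t
    rw [hd2, hαc]
    simp only [convolution]
    rw [← integral_const_mul, ← integral_add e2 (e1.const_mul _)]
    congr 1
    funext τ
    simp only [hL, hg2]
    simp only [hg]
    have hκ' : (κ : ℂ) ≠ 0 := by exact_mod_cast hκ.ne'
    push_cast
    field_simp
    ring
end
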